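/- For every triangulation T of P and every vector u ∈ ℝ^{n+1}, one has ⟨u, x(T)⟩ ≥ ⟨u, x(T')⟩ for all triangulations T' of P if and only if u_{s_δ} ≤ u_{t_δ} for every internal diagonal δ ∈ T. -/

import Mathlib

attribute [local instance] Classical.propDecidable

noncomputable section

namespace Spines

/-- Position of vertex `v ∈ {0,…,n+2}` in the counterclockwise boundary cyclic order:
`0`, then the elements of `D` in increasing order, then `n+2`, then the elements of `U`
in decreasing order. -/
def pos (n : ℕ) (D U : Finset ℕ) (v : ℕ) : ℕ :=
  if v = 0 then 0
  else if v = n + 2 then D.card + 1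
  else if v ∈ D then 1 + (D.filter (fun d => d < v)).card
  else D.card + 2 + (U.filter (fun u => v < u)).card

/-- Cyclic distance from `a` to `v` in counterclockwise direction. -/
def relpos (n : ℕ) (D U : Finset ℕ) (a v : ℕ) : ℕ :=
  (pos n D U v + (n + 3) - pos n D U a) % (n + 3)

/-- `v` lies strictly inside the counterclockwise boundary arc from `a` to `b`. -/
def StrictBetween (n : ℕ) (D U : Finset ℕ) (a b v : ℕ) : Prop :=
  v ≤ n + 2 ∧ 0 < relpos n D U a v ∧ relpos n D U a v < relpos n D U a b

/-- A diagonal, encoded as an ordered pair `(a,b)` with `a < b ≤ n+2`. -/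
def IsDiag (n : ℕ) (δ : ℕ × ℕ) : Prop := δ.1 < δ.2 ∧ δ.2 ≤ n + 2

/-- A boundary edge: the endpoints are adjacent in the cyclic order. -/
def IsBoundaryEdge (n : ℕ) (D U : Finset ℕ) (δ : ℕ × ℕ) : Prop :=
  IsDiag n δ ∧ (relpos n D U δ.1 δ.2 = 1 ∨ relpos n D U δ.2 δ.1 = 1)

/-- An internal diagonal. -/
def IsInternalDiag (n : ℕ) (D U : Finset ℕ) (δ : ℕ × ℕ) : Prop :=
  IsDiag n δ ∧ ¬ IsBoundaryEdge n D U δ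

/-- Two diagonals cross: the four endpoints are pairwise distinct and exactly one
endpoint of the second lies strictly inside each of the two arcs determined by the first. -/
def Cross (n : ℕ) (D U : Finset ℕ) (δ δ' : ℕ × ℕ) : Prop :=
  δ.1 ≠ δ.2 ∧ δ'.1 ≠ δ'.2 ∧ δ.1 ≠ δ'.1 ∧ δ.1 ≠ δ'.2 ∧ δ.2 ≠ δ'.1 ∧ δ.2 ≠ δ'.2 ∧
  ((StrictBetween n D U δ.1 δ.2 δ'.1 ∧ StrictBetween n D U δ.2 δ.1 δ'.2) ∨
   (StrictBetween n D U δ.1 δ.2 δ'.2 ∧ StrictBetween n D U δ.2 δ.1 δ'.1))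

/-- A triangulation: a maximal set of pairwise non-crossing internal diagonals. -/
def IsTriangulation (n : ℕ) (D U : Finset ℕ) (T : Finset (ℕ × ℕ)) : Prop :=
  (∀ δ ∈ T, IsInternalDiag n D U δ) ∧
  (∀ δ ∈ T, ∀ δ' ∈ T, ¬ Cross n D U δ δ') ∧
  (∀ δ, IsInternalDiag n D U δ → δ ∉ T → ∃ δ' ∈ T, Cross n D U δ δ')

/-- `a` and `b` (with `a < b`) are joined by a diagonal of `T` or a boundary edge. -/
def EdgeOf (n : ℕ) (D U : Finset ℕ) (T : Finset (ℕ × ℕ)) (a b : ℕ) : Prop :=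
  (a, b) ∈ T ∨ IsBoundaryEdge n D U (a, b)

/-- `{i,j,k}` with `i<j<k` is a triangle of the triangulation `T`. -/
def IsTriangleOf (n : ℕ) (D U : Finset ℕ) (T : Finset (ℕ × ℕ)) (i j k : ℕ) : Prop :=
  i < j ∧ j < k ∧ k ≤ n + 2 ∧
    EdgeOf n D U T i j ∧ EdgeOf n D U T j k ∧ EdgeOf n D U T i k

/-- `Bel δ`: labels in `[n+1]` strictly inside the ccw arc from `δ.1` to `δ.2`,
together with the endpoints of `δ` lying in `U`. -/
def Bel (n : ℕ) (D U : Finset ℕ) (δ : ℕ × ℕ) : Finset ℕ :=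
  (Finset.Icc 1 (n + 1)).filter
    (fun j => StrictBetween n D U δ.1 δ.2 j ∨ (j ∈ U ∧ (j = δ.1 ∨ j = δ.2)))

def bel (n : ℕ) (D U : Finset ℕ) (δ : ℕ × ℕ) : ℕ := (Bel n D U δ).card

def Abo (n : ℕ) (D U : Finset ℕ) (δ : ℕ × ℕ) : Finset ℕ :=
  Finset.Icc 1 (n + 1) \ Bel n D U δ

/-- The coordinates of the point `x(T)` associated to a triangulation `T`. -/
def xcoord (n : ℕ) (D U : Finset ℕ) (T : Finset (ℕ × ℕ)) (j : ℕ) : ℝ :=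
  if h : ∃ p : ℕ × ℕ, IsTriangleOf n D U T p.1 j p.2 then
    if j ∈ D then
      ((bel n D U (h.choose.1, j) : ℝ) + 1) * ((bel n D U (j, h.choose.2) : ℝ) + 1)
    else
      ((n : ℝ) + 2) -
        (((n : ℝ) + 2) - (bel n D U (h.choose.1, j) : ℝ)) *
          (((n : ℝ) + 2) - (bel n D U (j, h.choose.2) : ℝ))
  else 0

/-- Middle vertex of the triple `{a,b,c}` with `a < b` and `c ∉ {a,b}`. -/
def midOf (a b c : ℕ) : ℕ := if c < a then a else if c < b then c else b

/-- `c` is the third vertex of a triangle of `T` containing the diagonal `δ`. -/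
def TriWith (n : ℕ) (D U : Finset ℕ) (T : Finset (ℕ × ℕ)) (δ : ℕ × ℕ) (c : ℕ) : Prop :=
  if c < δ.1 then IsTriangleOf n D U T c δ.1 δ.2
  else if c < δ.2 then IsTriangleOf n D U T δ.1 c δ.2
  else IsTriangleOf n D U T δ.1 δ.2 c

/-- `s_δ`: middle vertex of the triangle of `T` below `δ` (third vertex strictly
inside the ccw arc from `δ.1` to `δ.2`). -/
def spineSrc (n : ℕ) (D U : Finset ℕ) (T : Finset (ℕ × ℕ)) (δ : ℕ × ℕ) : ℕ :=
  if h : ∃ c, StrictBetween n D U δ.1 δ.2 c ∧ TriWith n D U T δ c then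
    midOf δ.1 δ.2 h.choose
  else 0

/-- `t_δ`: middle vertex of the triangle of `T` above `δ` (third vertex strictly
inside the ccw arc from `δ.2` to `δ.1`). -/
def spineTgt (n : ℕ) (D U : Finset ℕ) (T : Finset (ℕ × ℕ)) (δ : ℕ × ℕ) : ℕ :=
  if h : ∃ c, StrictBetween n D U δ.2 δ.1 c ∧ TriWith n D U T δ c then
    midOf δ.1 δ.2 h.choose
  else 0

/-- `(p,q)` is an arc of the spine of `T`. -/
def SpineArc (n : ℕ) (D U : Finset ℕ) (T : Finset (ℕ × ℕ)) (p q : ℕ) : Prop :=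
  ∃ δ ∈ T, spineSrc n D U T δ = p ∧ spineTgt n D U T δ = q

/-- The finite set of all triangulations of the polygon. -/
def allTri (n : ℕ) (D U : Finset ℕ) : Finset (Finset (ℕ × ℕ)) :=
  ((Finset.range (n + 3) ×ˢ Finset.range (n + 3)).filter
      (fun δ => IsInternalDiag n D U δ)).powerset.filter
    (fun T => IsTriangulation n D U T)

end Spines

namespace Spines

/-- The labels `1, …, n + 1` are partitioned into down labels `D` and up labels `U`. -/
structure IsLabelling (n : ℕ) (D U : Finset ℕ) : Prop where
  cover : D ∪ U = Finset.Icc 1 (n + 1)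
  disj : Disjoint D U

/-- `x`, `y`, `z` are distinct and occur in this cyclic order. -/
def Cyc (x y z : ℕ) : Prop := (x < y ∧ y < z) ∨ (y < z ∧ z < x) ∨ (z < x ∧ x < y)

/-- The vertices `a`, `b`, `c` occur in this counterclockwise order. -/
def Ccw (n : ℕ) (D U : Finset ℕ) (a b c : ℕ) : Prop :=
  Cyc (pos n D U a) (pos n D U b) (pos n D U c)

/-- The median of three numbers. -/
def med (a b c : ℕ) : ℕ := max (min a b) (min (max a b) c)

variable {n : ℕ} {D U : Finset ℕ}

section Positions

theorem IsLabelling.mem_iff (h : IsLabelling n D U) {v : ℕ} :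
    v ∈ D ∨ v ∈ U ↔ 1 ≤ v ∧ v ≤ n + 1 := by
  rw [← Finset.mem_union, h.cover, Finset.mem_Icc]

theorem IsLabelling.notMem (h : IsLabelling n D U) {v : ℕ} (hD : v ∈ D) : v ∉ U :=
  Finset.disjoint_left.mp h.disj hD

theorem IsLabelling.pos_anti (h : IsLabelling n D U) {v w : ℕ} (hv : v ∈ U) (hvw : v < w)
    (hw : w ≤ n + 2) : pos n D U w < pos n D U v := by
  have h1 := h.mem_iff.mp (Or.inr hv)
  have h2 : v ∉ D := fun hD => h.notMem hD hv
  have hv' : pos n D U v = D.card + 2 + (U.filter (fun u => v < u)).card := by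
    rw [pos, if_neg (by omega), if_neg (by omega), if_neg h2]
  rw [hv', pos, if_neg (by omega)]
  split_ifs with hw1 hw2
  · omega
  · have := Finset.card_filter_le D (fun d => d < w)
    omega
  · have hwU : w ∈ U := (h.mem_iff.mpr ⟨by omega, by omega⟩).resolve_left hw2
    have : (U.filter (fun u => w < u)).card < (U.filter (fun u => v < u)).card := by
      apply Finset.card_lt_card
      refine Finset.ssubset_iff_subset_ne.mpr ⟨?_, ?_⟩
      · intro x hx
        simp only [Finset.mem_filter] at hx ⊢
        exact ⟨hx.1, by omega⟩
      · intro he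
        have : w ∈ U.filter (fun u => w < u) := by
          rw [he]; simp [hwU, hvw]
        simp at this
    omega

theorem IsLabelling.pos_mono (h : IsLabelling n D U) {v w : ℕ} (hv : v ∉ U) (hvw : v < w)
    (hw : w ≤ n + 2) : pos n D U v < pos n D U w := by
  rcases Nat.eq_zero_or_pos v with rfl | hv0
  · rw [pos, if_pos rfl, pos, if_neg (by omega)]
    split_ifs <;> omega
  have hvD : v ∈ D := (h.mem_iff.mpr ⟨by omega, by omega⟩).resolve_right hv
  have hv' : pos n D U v = 1 + (D.filter (fun d => d < v)).card := by
    rw [pos, if_neg (by omega), if_neg (by omega), if_pos hvD]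
  have hlt : (D.filter (fun d => d < v)).card < D.card := by
    apply Finset.card_lt_card
    refine Finset.ssubset_iff_subset_ne.mpr ⟨Finset.filter_subset _ _, fun he => ?_⟩
    have : v ∈ D.filter (fun d => d < v) := by rw [he]; exact hvD
    simp at this
  rw [hv', pos, if_neg (by omega)]
  split_ifs with hw1 hw2
  · omega
  · have : (D.filter (fun d => d < v)).card < (D.filter (fun d => d < w)).card := by
      apply Finset.card_lt_card
      refine Finset.ssubset_iff_subset_ne.mpr ⟨?_, ?_⟩
      · intro x hx
        simp only [Finset.mem_filter] at hx ⊢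
        exact ⟨hx.1, by omega⟩
      · intro he
        have : v ∈ D.filter (fun d => d < v) := by
          rw [he]; simp [hvD, hvw]
        simp at this
    omega
  · omega

theorem IsLabelling.pos_lt (h : IsLabelling n D U) {v : ℕ} (hv : v ≤ n + 2) :
    pos n D U v < n + 3 := by
  have hc : D.card + U.card = n + 1 := by
    rw [← Finset.card_union_of_disjoint h.disj, h.cover]; simp
  rw [pos]
  split_ifs with h0 h1 h2
  · omega
  · omega
  · have := Finset.card_filter_le D (fun d => d < v)
    omega
  · have hvU : v ∈ U := (h.mem_iff.mpr ⟨by omega, by omega⟩).resolve_left h2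
    have : (U.filter (fun u => v < u)).card < U.card := by
      apply Finset.card_lt_card
      refine Finset.ssubset_iff_subset_ne.mpr ⟨Finset.filter_subset _ _, fun he => ?_⟩
      have : v ∈ U.filter (fun u => v < u) := by rw [he]; exact hvU
      simp at this
    omega

/-- The indicator of the up labels, as a number. -/
def upInd (U : Finset ℕ) (v : ℕ) : ℕ := if v ∈ U then 1 else 0

theorem mem_iff_upInd {v : ℕ} : v ∈ U ↔ upInd U v = 1 := by
  by_cases hv : v ∈ U <;> simp [upInd, hv]

theorem upInd_eq_zero_iff {v : ℕ} : upInd U v = 0 ↔ v ∉ U := by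
  by_cases hv : v ∈ U <;> simp [upInd, hv]

/-- The positions of two vertices are ordered as the vertices, unless the smaller one is up. -/
theorem IsLabelling.pos_cmp (h : IsLabelling n D U) {v w : ℕ} (hv : v ≤ n + 2)
    (hw : w ≤ n + 2) :
    v = w ∨
      (v < w ∧ (upInd U v = 1 ∧ pos n D U w < pos n D U v ∨
        upInd U v = 0 ∧ pos n D U v < pos n D U w)) ∨
      (w < v ∧ (upInd U w = 1 ∧ pos n D U v < pos n D U w ∨
        upInd U w = 0 ∧ pos n D U w < pos n D U v)) := by
  simp only [← mem_iff_upInd, upInd_eq_zero_iff]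
  rcases lt_trichotomy v w with hlt | heq | hlt
  · refine Or.inr (Or.inl ⟨hlt, ?_⟩)
    by_cases hU : v ∈ U
    · exact Or.inl ⟨hU, h.pos_anti hU hlt hw⟩
    · exact Or.inr ⟨hU, h.pos_mono hU hlt hw⟩
  · exact Or.inl heq
  · refine Or.inr (Or.inr ⟨hlt, ?_⟩)
    by_cases hU : w ∈ U
    · exact Or.inl ⟨hU, h.pos_anti hU hlt hv⟩
    · exact Or.inr ⟨hU, h.pos_mono hU hlt hv⟩

theorem IsLabelling.pos_inj (h : IsLabelling n D U) {v w : ℕ} (hv : v ≤ n + 2)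
    (hw : w ≤ n + 2) (he : pos n D U v = pos n D U w) : v = w := by
  rcases h.pos_cmp hv hw with h1 | h1 | h1 <;> omega

theorem IsLabelling.exists_pos_eq (h : IsLabelling n D U) {k : ℕ} (hk : k < n + 3) :
    ∃ v ≤ n + 2, pos n D U v = k := by
  have := Finset.surj_on_of_inj_on_of_card_le (s := Finset.range (n + 3))
    (t := Finset.range (n + 3)) (fun v _ => pos n D U v)
    (fun v hv => by
      have := Finset.mem_range.mp hv
      exact Finset.mem_range.mpr (h.pos_lt (by omega)))
    (fun v w hv hw he => by
      have := Finset.mem_range.mp hv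
      have := Finset.mem_range.mp hw
      exact h.pos_inj (by omega) (by omega) he)
    le_rfl k (Finset.mem_range.mpr hk)
  obtain ⟨v, hv, he⟩ := this
  have := Finset.mem_range.mp hv
  exact ⟨v, by omega, he.symm⟩

theorem IsLabelling.relpos_eq (h : IsLabelling n D U) {a b : ℕ} (ha : a ≤ n + 2)
    (hb : b ≤ n + 2) :
    (pos n D U a ≤ pos n D U b ∧ relpos n D U a b + pos n D U a = pos n D U b) ∨
    (pos n D U b < pos n D U a ∧
      relpos n D U a b + pos n D U a = pos n D U b + (n + 3)) := by
  have h1 := h.pos_lt ha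
  have h2 := h.pos_lt hb
  rw [relpos]
  rcases le_or_gt (pos n D U a) (pos n D U b) with hle | hlt
  · left
    rw [show pos n D U b + (n + 3) - pos n D U a = pos n D U b - pos n D U a + (n + 3) by omega,
      Nat.add_mod_right, Nat.mod_eq_of_lt (by omega)]
    omega
  · right
    rw [Nat.mod_eq_of_lt (by omega)]
    omega

theorem IsLabelling.strictBetween_iff (h : IsLabelling n D U) {a b c : ℕ} (ha : a ≤ n + 2)
    (hb : b ≤ n + 2) : StrictBetween n D U a b c ↔ c ≤ n + 2 ∧ Ccw n D U a c b := by
  rw [StrictBetween, Ccw, Cyc]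
  refine and_congr_right fun hc => ?_
  have h1 := h.relpos_eq ha hb
  have h2 := h.relpos_eq ha hc
  have h3 := h.pos_lt ha
  have h4 := h.pos_lt hb
  have h5 := h.pos_lt hc
  omega

theorem Ccw.rotate {a b c : ℕ} (h : Ccw n D U a b c) : Ccw n D U b c a := by
  rw [Ccw, Cyc] at *; omega

theorem Ccw.ne {a b c : ℕ} (h : Ccw n D U a b c) : a ≠ b ∧ b ≠ c ∧ a ≠ c := by
  rw [Ccw, Cyc] at h
  refine ⟨?_, ?_, ?_⟩ <;> rintro rfl <;> omega

theorem IsLabelling.relpos_add (h : IsLabelling n D U) {a b c : ℕ} (ha : a ≤ n + 2)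
    (hb : b ≤ n + 2) (hc : c ≤ n + 2) (habc : Ccw n D U a b c) :
    relpos n D U a c = relpos n D U a b + relpos n D U b c := by
  rw [Ccw, Cyc] at habc
  have h1 := h.relpos_eq ha hb
  have h2 := h.relpos_eq hb hc
  have h3 := h.relpos_eq ha hc
  have h4 := h.pos_lt ha
  have h5 := h.pos_lt hb
  have h6 := h.pos_lt hc
  omega

theorem IsLabelling.relpos_add_swap (h : IsLabelling n D U) {a b : ℕ} (ha : a ≤ n + 2)
    (hb : b ≤ n + 2) (hab : a ≠ b) : relpos n D U a b + relpos n D U b a = n + 3 := by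
  have h1 := h.relpos_eq ha hb
  have h2 := h.relpos_eq hb ha
  have h3 : pos n D U a ≠ pos n D U b := fun he => hab (h.pos_inj ha hb he)
  omega

theorem IsLabelling.relpos_pos (h : IsLabelling n D U) {a b : ℕ} (ha : a ≤ n + 2)
    (hb : b ≤ n + 2) (hab : a ≠ b) : 0 < relpos n D U a b := by
  have h1 := h.relpos_eq ha hb
  have h3 : pos n D U a ≠ pos n D U b := fun he => hab (h.pos_inj ha hb he)
  have := h.pos_lt ha
  omega

/-- Every vertex has a successor in counterclockwise order. -/
theorem IsLabelling.exists_succ (h : IsLabelling n D U) {a : ℕ} (ha : a ≤ n + 2) :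
    ∃ v ≤ n + 2, relpos n D U a v = 1 := by
  have h1 := h.pos_lt ha
  by_cases hlast : pos n D U a = n + 2
  · obtain ⟨v, hv, he⟩ := h.exists_pos_eq (k := 0) (by omega)
    refine ⟨v, hv, ?_⟩
    have := h.relpos_eq ha hv
    omega
  · obtain ⟨v, hv, he⟩ := h.exists_pos_eq (k := pos n D U a + 1) (by omega)
    refine ⟨v, hv, ?_⟩
    have := h.relpos_eq ha hv
    omega

theorem IsLabelling.ne_of_relpos_eq_one (h : IsLabelling n D U) {a b : ℕ} (ha : a ≤ n + 2)
    (hab : relpos n D U a b = 1) : a ≠ b := by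
  rintro rfl
  have := h.relpos_eq ha ha
  omega

theorem IsLabelling.exists_ccw (h : IsLabelling n D U) {a b : ℕ} (ha : a ≤ n + 2)
    (hb : b ≤ n + 2) (hab : a ≠ b) (hne : relpos n D U a b ≠ 1) :
    ∃ v ≤ n + 2, relpos n D U a v = 1 ∧ Ccw n D U a v b := by
  obtain ⟨v, hv, h1⟩ := h.exists_succ ha
  have h0 := h.relpos_pos ha hb hab
  exact ⟨v, hv, h1, ((h.strictBetween_iff ha hb).mp ⟨hv, by omega, by omega⟩).2⟩

theorem IsLabelling.not_ccw (h : IsLabelling n D U) {a b c : ℕ} (ha : a ≤ n + 2)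
    (hb : b ≤ n + 2) (hc : c ≤ n + 2) (hab : relpos n D U a b = 1) : ¬ Ccw n D U a c b := by
  intro hcc
  have := ((h.strictBetween_iff ha hb).mpr ⟨hc, hcc⟩).2
  omega

end Positions

section Sides

/-- The labels of the triangles lying on the side of the counterclockwise arc from `a` to `b`. -/
def side (n : ℕ) (D U : Finset ℕ) (a b : ℕ) : Finset ℕ :=
  if a < b then Bel n D U (a, b) else Finset.Icc 1 (n + 1) \ Bel n D U (b, a)

theorem side_of_lt {a b : ℕ} (hab : a < b) : side n D U a b = Bel n D U (a, b) := if_pos hab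

theorem side_subset (a b : ℕ) : side n D U a b ⊆ Finset.Icc 1 (n + 1) := by
  rw [side]
  split_ifs
  · exact Finset.filter_subset _ _
  · exact Finset.sdiff_subset

theorem side_swap {a b : ℕ} (hab : a ≠ b) :
    side n D U b a = Finset.Icc 1 (n + 1) \ side n D U a b := by
  rw [side, side]
  have : Bel n D U (a, b) ⊆ Finset.Icc 1 (n + 1) := Finset.filter_subset _ _
  have h2 : Bel n D U (b, a) ⊆ Finset.Icc 1 (n + 1) := Finset.filter_subset _ _
  split_ifs
  · omega
  · rw [Finset.sdiff_sdiff_eq_self h2]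
  · rfl
  · omega

theorem IsLabelling.mem_side (h : IsLabelling n D U) {a b j : ℕ} (ha : a ≤ n + 2)
    (hb : b ≤ n + 2) (hab : a ≠ b) : j ∈ side n D U a b ↔ (1 ≤ j ∧ j ≤ n + 1) ∧
      (Ccw n D U a j b ∨
        ((j = a ∨ j = b) ∧ (upInd U j = 1 ∧ a < b ∨ upInd U j = 0 ∧ b < a))) := by
  rw [← mem_iff_upInd, upInd_eq_zero_iff]
  have key : ∀ {a b : ℕ}, a ≤ n + 2 → b ≤ n + 2 → (j ∈ Bel n D U (a, b) ↔
      (1 ≤ j ∧ j ≤ n + 1) ∧ (Ccw n D U a j b ∨ (j ∈ U ∧ (j = a ∨ j = b)))) := by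
    intro a b ha hb
    rw [Bel, Finset.mem_filter, Finset.mem_Icc, h.strictBetween_iff ha hb]
    refine and_congr_right fun hj => ?_
    simp only [show j ≤ n + 2 by omega, true_and]
  rw [side]
  split_ifs with hlt
  · rw [key ha hb]
    refine and_congr_right fun hj => ?_
    have : ¬ b < a := by omega
    simp only [hlt, this]
    tauto
  · rw [Finset.mem_sdiff, key hb ha, Finset.mem_Icc]
    refine and_congr_right fun hj => ?_
    have : b < a := by omega
    simp only [hlt, this, hj, true_and, not_or, not_and]
    have h1 : j ≠ a → j ≠ b → (¬ Ccw n D U b j a ↔ Ccw n D U a j b) := by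
      intro h1 h2
      have e1 : pos n D U j ≠ pos n D U a := fun he => h1 (h.pos_inj (by omega) ha he)
      have e2 : pos n D U j ≠ pos n D U b := fun he => h2 (h.pos_inj (by omega) hb he)
      have e3 : pos n D U a ≠ pos n D U b := fun he => hab (h.pos_inj ha hb he)
      simp only [Ccw, Cyc]
      omega
    have h2 : Ccw n D U b j a → j ≠ a ∧ j ≠ b := fun hc => ⟨hc.ne.2.1, hc.ne.1.symm⟩
    have h3 : Ccw n D U a j b → j ≠ a ∧ j ≠ b := fun hc => ⟨hc.ne.1.symm, hc.ne.2.1⟩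
    tauto

theorem upInd_eq_zero_or_one (v : ℕ) : upInd U v = 0 ∨ upInd U v = 1 := by
  by_cases hv : v ∈ U <;> simp [upInd, hv]

set_option maxHeartbeats 1000000 in
/-- Cutting along a triangle `a`, `c`, `b` partitions the labels on one side of `ab`. -/
theorem IsLabelling.mem_side_split (h : IsLabelling n D U) {a b c j : ℕ} (ha : a ≤ n + 2)
    (hb : b ≤ n + 2) (hc : c ≤ n + 2) (hacb : Ccw n D U a c b) :
    (j ∈ side n D U a b ↔
      j = med a c b ∨ j ∈ side n D U a c ∨ j ∈ side n D U c b) ∧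
    ¬ (j ∈ side n D U a c ∧ j ∈ side n D U c b) ∧
    ¬ (j = med a c b ∧ (j ∈ side n D U a c ∨ j ∈ side n D U c b)) := by
  have hne := hacb.ne
  rw [h.mem_side ha hb hne.2.2, h.mem_side ha hc hne.1,
    h.mem_side hc hb hne.2.1]
  have k1 := (h.pos_cmp ha hb).resolve_left hne.2.2
  have k2 := (h.pos_cmp ha hc).resolve_left hne.1
  have k3 := (h.pos_cmp hc hb).resolve_left hne.2.1
  obtain ⟨n1, n2, n3⟩ := hne
  by_cases hj : 1 ≤ j ∧ j ≤ n + 1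
  swap
  · simp only [hj, false_and, or_false, and_false, not_false_eq_true, and_true, false_iff, med]
    omega
  simp only [hj, true_and]
  simp only [Ccw, Cyc] at *
  rcases eq_or_ne j a with rfl | hja
  · have hu := upInd_eq_zero_or_one (U := U) j
    refine ⟨⟨fun _ => ?_, fun _ => ?_⟩, fun _ => ?_, fun _ => ?_⟩ <;>
      simp only [med, n1, n3, lt_self_iff_false, false_and, and_false, false_or, or_false,
        true_and, hj] at * <;>
      rcases hu with hu | hu <;>
      simp only [hu, zero_ne_one, one_ne_zero, true_and, false_and, or_false, false_or] at * <;>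
      omega
  rcases eq_or_ne j b with rfl | hjb
  · have hu := upInd_eq_zero_or_one (U := U) j
    refine ⟨⟨fun _ => ?_, fun _ => ?_⟩, fun _ => ?_, fun _ => ?_⟩ <;>
      simp only [med, n2.symm, n3.symm, lt_self_iff_false, false_and, and_false, false_or,
        or_false, or_true, true_and, hj] at * <;>
      rcases hu with hu | hu <;>
      simp only [hu, zero_ne_one, one_ne_zero, true_and, false_and, or_false, false_or] at * <;>
      omega
  rcases eq_or_ne j c with rfl | hjc
  · have hu := upInd_eq_zero_or_one (U := U) j
    refine ⟨⟨fun _ => ?_, fun _ => ?_⟩, fun _ => ?_, fun _ => ?_⟩ <;>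
      simp only [med, n2, n1.symm, lt_self_iff_false, false_and, and_false, false_or, or_false,
        or_true, true_and, hj] at * <;>
      rcases hu with hu | hu <;>
      simp only [hu, zero_ne_one, one_ne_zero, true_and, false_and, or_false, false_or] at * <;>
      omega
  have e1 : pos n D U j ≠ pos n D U a := fun he => hja (h.pos_inj (by omega) ha he)
  have e2 : pos n D U j ≠ pos n D U b := fun he => hjb (h.pos_inj (by omega) hb he)
  have e3 : pos n D U j ≠ pos n D U c := fun he => hjc (h.pos_inj (by omega) hc he)
  simp only [hja, hjb, hjc, false_and, or_false, med]
  omega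

theorem IsLabelling.sum_side_split (h : IsLabelling n D U) {a b c : ℕ} (ha : a ≤ n + 2)
    (hb : b ≤ n + 2) (hc : c ≤ n + 2) (hacb : Ccw n D U a c b) {M : Type*} [AddCommMonoid M]
    (f : ℕ → M) :
    ∑ j ∈ side n D U a b, f j =
      f (med a c b) + (∑ j ∈ side n D U a c, f j + ∑ j ∈ side n D U c b, f j) := by
  have key := fun j => h.mem_side_split (j := j) ha hb hc hacb
  have e : side n D U a b = insert (med a c b) (side n D U a c ∪ side n D U c b) := by
    ext j
    rw [(key j).1, Finset.mem_insert, Finset.mem_union]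
  rw [e, Finset.sum_insert, Finset.sum_union]
  · exact Finset.disjoint_left.mpr fun j h1 h2 => (key j).2.1 ⟨h1, h2⟩
  · rw [Finset.mem_union]
    exact fun h1 => (key _).2.2 ⟨rfl, h1⟩

theorem sum_side_swap {a b : ℕ} (hab : a ≠ b) (f : ℕ → ℝ) :
    ∑ j ∈ side n D U a b, f j + ∑ j ∈ side n D U b a, f j = ∑ j ∈ Finset.Icc 1 (n + 1), f j := by
  rw [side_swap hab, add_comm, Finset.sum_sdiff (side_subset a b)]

theorem IsLabelling.side_eq_empty (h : IsLabelling n D U) {a b : ℕ} (ha : a ≤ n + 2)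
    (hb : b ≤ n + 2) (hab : relpos n D U a b = 1) : side n D U a b = ∅ := by
  have hne := h.ne_of_relpos_eq_one ha hab
  refine Finset.eq_empty_of_forall_notMem fun j hj => ?_
  rw [h.mem_side ha hb hne] at hj
  rcases hj.2 with h1 | h1
  · exact h.not_ccw ha hb (by omega) hab h1
  have h0 : upInd U 0 = 0 := upInd_eq_zero_iff.mpr fun h' => by
    have := h.mem_iff.mp (Or.inr h'); omega
  have k0 := h.not_ccw ha hb (c := 0) (by omega) hab
  have kt := h.not_ccw ha hb (c := n + 2) (by omega) hab
  have k1 := h.pos_cmp ha hb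
  have k2 := h.pos_cmp ha (w := 0) (by omega)
  have k3 := h.pos_cmp hb (w := 0) (by omega)
  have k4 := h.pos_cmp ha (w := n + 2) (by omega)
  have k5 := h.pos_cmp hb (w := n + 2) (by omega)
  simp only [Ccw, Cyc] at *
  rcases h1 with ⟨rfl | rfl, h1⟩ <;> omega

theorem IsLabelling.card_side (h : IsLabelling n D U) {a b : ℕ} (ha : a ≤ n + 2)
    (hb : b ≤ n + 2) (hab : a ≠ b) : (side n D U a b).card + 1 = relpos n D U a b := by
  induction hr : relpos n D U a b using Nat.strong_induction_on generalizing a b with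
  | _ r ih =>
  subst hr
  by_cases h1 : relpos n D U a b = 1
  · rw [h.side_eq_empty ha hb h1, h1]; simp
  obtain ⟨c, hc, -, hacb⟩ := h.exists_ccw ha hb hab h1
  have hadd := h.relpos_add ha hc hb hacb
  have p1 := h.relpos_pos ha hc hacb.ne.1
  have p2 := h.relpos_pos hc hb hacb.ne.2.1
  have i1 := ih _ (by omega) ha hc hacb.ne.1 rfl
  have i2 := ih _ (by omega) hc hb hacb.ne.2.1 rfl
  have := h.sum_side_split ha hb hc hacb (fun _ => 1)
  simp only [← Finset.card_eq_sum_ones] at this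
  omega

theorem IsLabelling.bel_eq (h : IsLabelling n D U) {a b : ℕ} (hab : a < b) (hb : b ≤ n + 2) :
    bel n D U (a, b) + 1 = relpos n D U a b := by
  rw [bel, ← side_of_lt hab, h.card_side (by omega) hb hab.ne]

end Sides

section Triangulations

variable {T : Finset (ℕ × ℕ)}

/-- `a` and `b` are joined by a diagonal of `T` or by a boundary edge. -/
def Joined (n : ℕ) (D U : Finset ℕ) (T : Finset (ℕ × ℕ)) (a b : ℕ) : Prop :=
  EdgeOf n D U T (min a b) (max a b)

/-- `a`, `c`, `b` is a counterclockwise triangle of `T`. -/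
def IsTri (n : ℕ) (D U : Finset ℕ) (T : Finset (ℕ × ℕ)) (a c b : ℕ) : Prop :=
  Ccw n D U a c b ∧ Joined n D U T a c ∧ Joined n D U T c b ∧ Joined n D U T a b

theorem Joined.symm {a b : ℕ} (hab : Joined n D U T a b) : Joined n D U T b a := by
  rwa [Joined, min_comm, max_comm]

theorem joined_of_lt {a b : ℕ} (hab : a < b) : Joined n D U T a b ↔ EdgeOf n D U T a b := by
  rw [Joined, min_eq_left hab.le, max_eq_right hab.le]

theorem IsTri.rotate {a b c : ℕ} (h : IsTri n D U T a c b) : IsTri n D U T c b a :=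
  ⟨h.1.rotate, h.2.2.1, h.2.2.2.symm, h.2.1.symm⟩

theorem IsLabelling.cross_iff (h : IsLabelling n D U) {δ δ' : ℕ × ℕ} (hδ : IsDiag n δ)
    (hδ' : IsDiag n δ') : Cross n D U δ δ' ↔
      (Ccw n D U δ.1 δ'.1 δ.2 ∧ Ccw n D U δ.2 δ'.2 δ.1) ∨
      (Ccw n D U δ.1 δ'.2 δ.2 ∧ Ccw n D U δ.2 δ'.1 δ.1) := by
  obtain ⟨a, b⟩ := δ
  obtain ⟨c, d⟩ := δ'
  simp only [IsDiag, Cross] at *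
  have ha : a ≤ n + 2 := by omega
  have hc : c ≤ n + 2 := by omega
  rw [h.strictBetween_iff ha hδ.2, h.strictBetween_iff ha hδ.2, h.strictBetween_iff hδ.2 ha,
    h.strictBetween_iff hδ.2 ha]
  constructor
  · tauto
  · rintro (⟨h1, h2⟩ | ⟨h1, h2⟩)
    · have := h1.ne; have := h2.ne
      exact ⟨by omega, by omega, by omega, by omega, by omega, by omega,
        Or.inl ⟨⟨hc, h1⟩, ⟨hδ'.2, h2⟩⟩⟩
    · have := h1.ne; have := h2.ne
      exact ⟨by omega, by omega, by omega, by omega, by omega, by omega,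
        Or.inr ⟨⟨hδ'.2, h1⟩, ⟨hc, h2⟩⟩⟩

theorem EdgeOf.isDiag (hT : IsTriangulation n D U T) {a b : ℕ} (hab : EdgeOf n D U T a b) :
    IsDiag n (a, b) :=
  hab.elim (fun hm => (hT.1 _ hm).1) (fun hb => hb.1)

theorem Joined.bounds (hT : IsTriangulation n D U T) {a b : ℕ} (hab : Joined n D U T a b) :
    a ≤ n + 2 ∧ b ≤ n + 2 ∧ a ≠ b := by
  have := EdgeOf.isDiag hT hab
  simp only [IsDiag] at this
  omega

theorem IsLabelling.not_ccw_of_edgeOf (h : IsLabelling n D U) (hT : IsTriangulation n D U T)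
    {a b c d : ℕ} (hab : EdgeOf n D U T a b) (hcd : EdgeOf n D U T c d) :
    ¬ ((Ccw n D U a c b ∧ Ccw n D U b d a) ∨ (Ccw n D U a d b ∧ Ccw n D U b c a)) := by
  have b1 := hab.isDiag hT
  have b2 := hcd.isDiag hT
  rcases hab with m1 | ⟨-, m1⟩
  · rcases hcd with m2 | ⟨-, m2⟩
    · have := hT.2.1 _ m1 _ m2
      rwa [h.cross_iff b1 b2] at this
    · simp only [IsDiag] at b1 b2 m2
      have k1 := fun (x : ℕ) hx => h.not_ccw (a := c) (b := d) (c := x) (by omega) (by omega) hx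
      have k2 := fun (x : ℕ) hx => h.not_ccw (a := d) (b := c) (c := x) (by omega) (by omega) hx
      have k3 := k1 a (by omega)
      have k4 := k1 b (by omega)
      have k5 := k2 a (by omega)
      have k6 := k2 b (by omega)
      simp only [Ccw, Cyc] at *
      omega
  · simp only [IsDiag] at b1 b2 m1
    have k1 := fun (x : ℕ) hx => h.not_ccw (a := a) (b := b) (c := x) (by omega) (by omega) hx
    have k2 := fun (x : ℕ) hx => h.not_ccw (a := b) (b := a) (c := x) (by omega) (by omega) hx
    have k3 := k1 c (by omega)
    have k4 := k1 d (by omega)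
    have k5 := k2 c (by omega)
    have k6 := k2 d (by omega)
    tauto

theorem IsLabelling.not_ccw_of_joined (h : IsLabelling n D U) (hT : IsTriangulation n D U T)
    {a b c d : ℕ} (hab : Joined n D U T a b) (hcd : Joined n D U T c d) :
    ¬ (Ccw n D U a c b ∧ Ccw n D U b d a) := by
  have := h.not_ccw_of_edgeOf hT hab hcd
  rcases le_total a b with h1 | h1 <;> rcases le_total c d with h2 | h2 <;>
    simp only [h1, h2, min_eq_left, min_eq_right, max_eq_left, max_eq_right] at this <;> tauto

theorem IsLabelling.joined_of_relpos (h : IsLabelling n D U) {a b : ℕ} (ha : a ≤ n + 2)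
    (hb : b ≤ n + 2) (hab : relpos n D U a b = 1) : Joined n D U T a b := by
  have hne := h.ne_of_relpos_eq_one ha hab
  rcases lt_or_gt_of_ne hne with hlt | hlt
  · rw [joined_of_lt hlt]
    exact Or.inr ⟨⟨hlt, hb⟩, Or.inl hab⟩
  · apply Joined.symm
    rw [joined_of_lt hlt]
    exact Or.inr ⟨⟨hlt, ha⟩, Or.inr hab⟩

/-- A pair of vertices crossed by no edge of a triangulation is an edge. -/
theorem IsLabelling.joined_of_forall (h : IsLabelling n D U) (hT : IsTriangulation n D U T)
    {a b : ℕ} (ha : a ≤ n + 2) (hb : b ≤ n + 2) (hab : a ≠ b)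
    (hcross : ∀ c d, Joined n D U T c d → ¬ (Ccw n D U a c b ∧ Ccw n D U b d a)) :
    Joined n D U T a b := by
  have key : ∀ {a b : ℕ}, b ≤ n + 2 → a < b →
      (∀ c d, Joined n D U T c d → ¬ (Ccw n D U a c b ∧ Ccw n D U b d a)) →
      Joined n D U T a b := by
    intro a b hb hab hcross
    rw [joined_of_lt hab]
    by_contra hno
    rw [EdgeOf, not_or] at hno
    obtain ⟨⟨c, d⟩, hm, hc⟩ := hT.2.2 (a, b) ⟨⟨hab, hb⟩, hno.2⟩ hno.1
    have hd := (hT.1 _ hm).1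
    rw [h.cross_iff ⟨hab, hb⟩ hd] at hc
    have hj : Joined n D U T c d := (joined_of_lt hd.1).mpr (Or.inl hm)
    exact hc.elim (hcross c d hj) (hcross d c hj.symm)
  rcases lt_or_gt_of_ne hab with hlt | hlt
  · exact key hb hlt hcross
  · exact (key ha hlt fun c d hcd hx => hcross d c hcd.symm ⟨hx.2, hx.1⟩).symm

theorem IsLabelling.exists_isTri (h : IsLabelling n D U) (hT : IsTriangulation n D U T)
    {a b : ℕ} (hab : Joined n D U T a b) (hne : relpos n D U a b ≠ 1) :
    ∃ c, IsTri n D U T a c b := by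
  obtain ⟨ha, hb, hab'⟩ := hab.bounds hT
  obtain ⟨v, hv, hv1, hv2⟩ := h.exists_ccw ha hb hab' hne
  obtain ⟨c, hc, hmax⟩ := Finset.exists_max_image
    ((Finset.range (n + 3)).filter fun v => Ccw n D U a v b ∧ Joined n D U T a v)
    (fun v => relpos n D U a v)
    ⟨v, Finset.mem_filter.mpr ⟨Finset.mem_range.mpr (by omega), hv2,
      h.joined_of_relpos ha hv hv1⟩⟩
  simp only [Finset.mem_filter, Finset.mem_range, and_imp] at hc hmax
  obtain ⟨hc, hacb, hac⟩ := hc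
  have hc' : c ≤ n + 2 := by omega
  refine ⟨c, hacb, hac, ?_, hab⟩
  refine h.joined_of_forall hT hc' hb hacb.ne.2.1 fun x y hxy hx => ?_
  obtain ⟨bx, by', -⟩ := hxy.bounds hT
  have n1 := h.not_ccw_of_joined hT hab hxy
  have n2 := h.not_ccw_of_joined hT hac hxy.symm
  clear hab hac hv hv1 hv2
  rcases eq_or_ne y a with rfl | hya
  · have e1 := fun hh => hmax x (by omega) hh hxy.symm
    have r1 := h.relpos_eq ha hc'
    have r2 := h.relpos_eq ha bx
    have p1 := h.pos_lt hc'
    have p2 := h.pos_lt bx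
    clear hmax n1 n2 hne hc hc'
    simp only [Ccw, Cyc] at *
    omega
  · have e1 : pos n D U y ≠ pos n D U a := fun he => hya (h.pos_inj by' ha he)
    clear hmax hne
    simp only [Ccw, Cyc] at *
    omega

theorem IsLabelling.isTri_unique (h : IsLabelling n D U) (hT : IsTriangulation n D U T)
    {a b c d : ℕ} (hc : IsTri n D U T a c b) (hd : IsTri n D U T a d b) : c = d := by
  by_contra hcd
  have b1 := hc.2.1.bounds hT
  have b2 := hd.2.1.bounds hT
  have e1 : pos n D U c ≠ pos n D U d := fun he => hcd (h.pos_inj b1.2.1 b2.2.1 he)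
  have n1 := h.not_ccw_of_joined hT hd.2.1 hc.2.2.1
  have n2 := h.not_ccw_of_joined hT hc.2.1 hd.2.2.1
  have c1 := hc.1
  have c2 := hd.1
  simp only [Ccw, Cyc] at *
  omega

theorem IsLabelling.isTri_of_isTriangleOf (h : IsLabelling n D U) {i j k : ℕ}
    (ht : IsTriangleOf n D U T i j k) :
    (j ∈ D ∧ IsTri n D U T i j k) ∨ (j ∈ U ∧ j ∉ D ∧ IsTri n D U T k j i) := by
  obtain ⟨hij, hjk, hk, e1, e2, e3⟩ := ht
  rw [← joined_of_lt hij] at e1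
  rw [← joined_of_lt hjk] at e2
  rw [← joined_of_lt (hij.trans hjk)] at e3
  have k1 := h.pos_cmp (v := i) (w := j) (by omega) (by omega)
  have k2 := h.pos_cmp (v := j) (w := k) (by omega) (by omega)
  have k3 := h.pos_cmp (v := i) (w := k) (by omega) (by omega)
  rcases h.mem_iff (v := j) |>.mpr ⟨by omega, by omega⟩ with hD | hU
  · refine Or.inl ⟨hD, ?_, e1, e2, e3⟩
    have : upInd U j = 0 := upInd_eq_zero_iff.mpr (h.notMem hD)
    simp only [Ccw, Cyc]
    omega
  · refine Or.inr ⟨hU, fun hD => h.notMem hD hU, ?_, e2.symm, e1.symm, e3.symm⟩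
    have : upInd U j = 1 := mem_iff_upInd.mp hU
    simp only [Ccw, Cyc]
    omega

theorem IsLabelling.ccw_of_lt (h : IsLabelling n D U) {i j k : ℕ} (hij : i < j) (hjk : j < k)
    (hk : k ≤ n + 2) : (upInd U j = 0 ∧ Ccw n D U i j k) ∨ (upInd U j = 1 ∧ Ccw n D U k j i) := by
  have k1 := h.pos_cmp (v := i) (w := j) (by omega) (by omega)
  have k2 := h.pos_cmp (v := j) (w := k) (by omega) (by omega)
  have k3 := h.pos_cmp (v := i) (w := k) (by omega) (by omega)
  simp only [Ccw, Cyc]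
  omega

theorem IsLabelling.isTriangleOf_unique (h : IsLabelling n D U) (hT : IsTriangulation n D U T)
    {i j k i' k' : ℕ} (ht : IsTriangleOf n D U T i j k) (ht' : IsTriangleOf n D U T i' j k') :
    i = i' ∧ k = k' := by
  have key : ∀ {x y x' y' : ℕ}, IsTri n D U T x j y → IsTri n D U T x' j y' →
      Ccw n D U j y x' → Ccw n D U j y' x → x = x' ∧ y = y' := by
    intro x y x' y' t1 t2 d1 d2
    have b1 := t1.2.2.2.bounds hT
    have b2 := t2.2.2.2.bounds hT
    have n1 := h.not_ccw_of_joined hT t2.2.2.1 t1.2.2.2.symm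
    have n2 := h.not_ccw_of_joined hT t1.2.2.1 t2.2.2.2.symm
    have n3 := h.not_ccw_of_joined hT t1.2.1.symm t2.2.2.2.symm
    have n4 := h.not_ccw_of_joined hT t2.2.1.symm t1.2.2.2.symm
    have c1 := t1.1
    have c2 := t2.1
    have hy : y = y' := by
      refine h.pos_inj b1.2.1 b2.2.1 ?_
      clear b1 b2 ht ht' n3 n4 t1 t2
      simp only [Ccw, Cyc] at *
      omega
    subst hy
    refine ⟨h.pos_inj b1.1 b2.1 ?_, rfl⟩
    clear b1 b2 ht ht' n1 n2 t1 t2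
    simp only [Ccw, Cyc] at *
    omega
  have t1 := h.isTri_of_isTriangleOf ht
  have t2 := h.isTri_of_isTriangleOf ht'
  obtain ⟨l1, l2, l3, -⟩ := ht
  obtain ⟨l1', l2', l3', -⟩ := ht'
  rcases t1 with ⟨hD, t1⟩ | ⟨hU, hD, t1⟩ <;> rcases t2 with ⟨hD', t2⟩ | ⟨hU', hD', t2⟩
  · have := upInd_eq_zero_iff.mpr (h.notMem hD)
    have d1 := (h.ccw_of_lt l1' l2 l3).resolve_right (by omega)
    have d2 := (h.ccw_of_lt l1 l2' l3').resolve_right (by omega)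
    exact key t1 t2 d1.2.rotate d2.2.rotate
  · exact absurd hD hD'
  · exact absurd hD' hD
  · have := mem_iff_upInd.mp hU
    have d1 := (h.ccw_of_lt l1' l2 l3).resolve_left (by omega)
    have d2 := (h.ccw_of_lt l1 l2' l3').resolve_left (by omega)
    exact (key t1 t2 d2.2.rotate d1.2.rotate).symm

end Triangulations

section Coordinates

variable {T : Finset (ℕ × ℕ)}

theorem med_rotate (a b c : ℕ) : med a b c = med b c a := by
  simp only [med]; omega

/-- The sum of the coordinates of `x(T)` over the labels on one side of an edge of `T`. -/
def psi (n : ℕ) (D U : Finset ℕ) (a b : ℕ) : ℝ :=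
  if a < b then (relpos n D U a b : ℝ) * (relpos n D U a b - 1) / 2
  else ((n : ℝ) + 2) * (n + 1) / 2 -
    ((n : ℝ) + 3 - relpos n D U a b) * (n + 2 - relpos n D U a b) / 2

theorem IsLabelling.relpos_swap (h : IsLabelling n D U) {a b : ℕ} (ha : a ≤ n + 2)
    (hb : b ≤ n + 2) (hab : a ≠ b) :
    (relpos n D U b a : ℝ) = n + 3 - relpos n D U a b := by
  have : (relpos n D U a b : ℝ) + relpos n D U b a = n + 3 := mod_cast h.relpos_add_swap ha hb hab
  linarith

theorem IsLabelling.psi_swap (h : IsLabelling n D U) {a b : ℕ} (ha : a ≤ n + 2)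
    (hb : b ≤ n + 2) (hab : a ≠ b) :
    psi n D U a b + psi n D U b a = ((n : ℝ) + 2) * (n + 1) / 2 := by
  have := h.relpos_swap ha hb hab
  rw [psi, psi, this]
  split_ifs
  · omega
  · ring
  · ring
  · omega

theorem psi_of_relpos {a b : ℕ} (hab : relpos n D U a b = 1) : psi n D U a b = 0 := by
  rw [psi, hab]
  split_ifs <;> push_cast <;> ring

theorem IsLabelling.xcoord_eq (h : IsLabelling n D U) (hT : IsTriangulation n D U T)
    {i j k : ℕ} (ht : IsTriangleOf n D U T i j k) :
    xcoord n D U T j = if j ∈ D then (relpos n D U i j : ℝ) * relpos n D U j k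
      else (n : ℝ) + 2 - (n + 3 - relpos n D U i j) * (n + 3 - relpos n D U j k) := by
  have hex : ∃ p : ℕ × ℕ, IsTriangleOf n D U T p.1 j p.2 := ⟨(i, k), ht⟩
  obtain ⟨e1, e2⟩ := h.isTriangleOf_unique hT hex.choose_spec ht
  rw [xcoord, dif_pos hex, e1, e2]
  have r1 : (bel n D U (i, j) : ℝ) + 1 = relpos n D U i j :=
    mod_cast h.bel_eq ht.1 (ht.2.1.le.trans ht.2.2.1)
  have r2 : (bel n D U (j, k) : ℝ) + 1 = relpos n D U j k := mod_cast h.bel_eq ht.2.1 ht.2.2.1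
  rw [← r1, ← r2]
  split_ifs
  · rfl
  · ring

theorem IsTri.isTriangleOf (hT : IsTriangulation n D U T) {a b c : ℕ} (ht : IsTri n D U T a c b)
    (hm : med a c b = c) : (a < c ∧ c < b ∧ IsTriangleOf n D U T a c b) ∨
      (b < c ∧ c < a ∧ IsTriangleOf n D U T b c a) := by
  obtain ⟨hc, e1, e2, e3⟩ := ht
  have h1 := e1.bounds hT
  have h2 := e2.bounds hT
  have h3 := e3.bounds hT
  have : (a < c ∧ c < b) ∨ (b < c ∧ c < a) := by
    simp only [med] at hm; omega
  rcases this with ⟨l1, l2⟩ | ⟨l1, l2⟩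
  · exact Or.inl ⟨l1, l2, l1, l2, h3.2.1, (joined_of_lt l1).mp e1, (joined_of_lt l2).mp e2,
      (joined_of_lt (l1.trans l2)).mp e3⟩
  · exact Or.inr ⟨l1, l2, l1, l2, h3.1, (joined_of_lt l1).mp e2.symm,
      (joined_of_lt l2).mp e1.symm, (joined_of_lt (l1.trans l2)).mp e3.symm⟩

/-- A rotation of any triangle has its middle vertex as second vertex. -/
theorem IsTri.exists_med {a b c : ℕ} (ht : IsTri n D U T a c b) :
    ∃ x y z, IsTri n D U T x y z ∧ med x y z = y ∧ y = med a c b ∧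
      ((x = a ∧ y = c ∧ z = b) ∨ (x = c ∧ y = b ∧ z = a) ∨ (x = b ∧ y = a ∧ z = c)) := by
  have hm : med a c b = c ∨ med a c b = b ∨ med a c b = a := by
    simp only [med]; omega
  rcases hm with hm | hm | hm
  · exact ⟨a, c, b, ht, hm, hm.symm, by tauto⟩
  · exact ⟨c, b, a, ht.rotate, by rw [← med_rotate, hm], hm.symm, by tauto⟩
  · exact ⟨b, a, c, ht.rotate.rotate, by rw [← med_rotate, ← med_rotate, hm], hm.symm, by tauto⟩

theorem IsLabelling.xcoord_med (h : IsLabelling n D U) (hT : IsTriangulation n D U T)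
    {a b c : ℕ} (ht : IsTri n D U T a c b) :
    xcoord n D U T (med a c b) = psi n D U a b - psi n D U a c - psi n D U c b := by
  have key : ∀ {a b c : ℕ}, IsTri n D U T a c b → med a c b = c →
      xcoord n D U T c = psi n D U a b - psi n D U a c - psi n D U c b := by
    intro a b c ht hm
    have b1 := ht.2.1.bounds hT
    have b2 := ht.2.2.1.bounds hT
    have hadd : (relpos n D U a b : ℝ) = relpos n D U a c + relpos n D U c b :=
      mod_cast h.relpos_add b1.1 b1.2.1 b2.2.1 ht.1
    rcases ht.isTriangleOf hT hm with ⟨l1, l2, hto⟩ | ⟨l1, l2, hto⟩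
    · have hD : c ∈ D := by
        rcases h.isTri_of_isTriangleOf hto with h1 | h1
        · exact h1.1
        · have := h1.2.2.1
          have := ht.1
          simp only [Ccw, Cyc] at *
          omega
      rw [h.xcoord_eq hT hto, if_pos hD, psi, psi, psi, if_pos l1, if_pos l2,
        if_pos (l1.trans l2), hadd]
      ring
    · have hD : c ∉ D := by
        rcases h.isTri_of_isTriangleOf hto with h1 | h1
        · have := h1.2.1
          have := ht.1
          simp only [Ccw, Cyc] at *
          omega
        · exact h1.2.1
      rw [h.xcoord_eq hT hto, if_neg hD, psi, psi, psi, if_neg (by omega), if_neg (by omega),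
        if_neg (by omega), hadd, h.relpos_swap b1.1 b1.2.1 b1.2.2, h.relpos_swap b2.1 b2.2.1 b2.2.2]
      ring
  obtain ⟨x, y, z, ht', hm, hy, hx⟩ := ht.exists_med
  have := key ht' hm
  rw [← hy, this]
  have s1 := fun {p q : ℕ} (hj : Joined n D U T p q) =>
    h.psi_swap (hj.bounds hT).1 (hj.bounds hT).2.1 (hj.bounds hT).2.2
  have k1 := s1 ht.2.1
  have k2 := s1 ht.2.2.1
  have k3 := s1 ht.2.2.2
  rcases hx with ⟨rfl, rfl, rfl⟩ | ⟨rfl, rfl, rfl⟩ | ⟨rfl, rfl, rfl⟩ <;> linarith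

/-- Induction along the triangles on one side of an edge. -/
theorem IsLabelling.joined_induction (h : IsLabelling n D U) (hT : IsTriangulation n D U T)
    {P : ℕ → ℕ → Prop}
    (base : ∀ a b, a ≤ n + 2 → b ≤ n + 2 → relpos n D U a b = 1 → P a b)
    (step : ∀ a b c, IsTri n D U T a c b → P a c → P c b → P a b)
    {a b : ℕ} (hab : Joined n D U T a b) : P a b := by
  induction hr : relpos n D U a b using Nat.strong_induction_on generalizing a b with
  | _ r ih =>
  obtain ⟨ha, hb, hne⟩ := hab.bounds hT
  subst hr
  by_cases h1 : relpos n D U a b = 1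
  · exact base a b ha hb h1
  obtain ⟨c, hc⟩ := h.exists_isTri hT hab h1
  have hcb := (hc.2.1.bounds hT).2.1
  have hadd := h.relpos_add ha hcb hb hc.1
  have p1 := h.relpos_pos ha hcb hc.1.ne.1
  have p2 := h.relpos_pos hcb hb hc.1.ne.2.1
  exact step a b c hc (ih _ (by omega) hc.2.1 rfl) (ih _ (by omega) hc.2.2.1 rfl)

theorem IsLabelling.sum_side_tri (h : IsLabelling n D U) (hT : IsTriangulation n D U T)
    {a b c : ℕ} (ht : IsTri n D U T a c b) (f : ℕ → ℝ) :
    ∑ j ∈ side n D U a b, f j =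
      f (med a c b) + (∑ j ∈ side n D U a c, f j + ∑ j ∈ side n D U c b, f j) :=
  h.sum_side_split (ht.2.2.2.bounds hT).1 (ht.2.2.2.bounds hT).2.1 (ht.2.1.bounds hT).2.1 ht.1 f

theorem IsLabelling.sum_xcoord_side (h : IsLabelling n D U) (hT : IsTriangulation n D U T)
    {a b : ℕ} (hab : Joined n D U T a b) :
    ∑ j ∈ side n D U a b, xcoord n D U T j = psi n D U a b := by
  refine h.joined_induction hT
    (P := fun a b => ∑ j ∈ side n D U a b, xcoord n D U T j = psi n D U a b) ?_ ?_ hab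
  · intro a b ha hb h1
    rw [h.side_eq_empty ha hb h1, psi_of_relpos h1, Finset.sum_empty]
  · intro a b c ht i1 i2
    rw [h.sum_side_tri hT ht, i1, i2, h.xcoord_med hT ht]
    ring

/-- Some boundary edge has all labels on one of its sides. -/
theorem IsLabelling.exists_side_eq (h : IsLabelling n D U) (T : Finset (ℕ × ℕ)) :
    ∃ a b, relpos n D U b a = 1 ∧ Joined n D U T a b ∧
      side n D U a b = Finset.Icc 1 (n + 1) := by
  obtain ⟨v, hv, h1⟩ := h.exists_succ (a := 0) (by omega)
  refine ⟨v, 0, h1, (h.joined_of_relpos (by omega) hv h1).symm, ?_⟩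
  rw [side_swap (h.ne_of_relpos_eq_one (by omega) h1), h.side_eq_empty (by omega) hv h1,
    Finset.sdiff_empty]

theorem IsLabelling.sum_xcoord (h : IsLabelling n D U) (hT : IsTriangulation n D U T) :
    ∑ j ∈ Finset.Icc 1 (n + 1), xcoord n D U T j = ((n : ℝ) + 2) * (n + 1) / 2 := by
  obtain ⟨a, b, h1, hab, hs⟩ := h.exists_side_eq T
  have hbd := hab.bounds hT
  rw [← hs, h.sum_xcoord_side hT hab, ← h.psi_swap hbd.1 hbd.2.1 hbd.2.2, psi_of_relpos h1,
    add_zero]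

theorem IsLabelling.exists_isTri_med (h : IsLabelling n D U) (hT : IsTriangulation n D U T)
    {j : ℕ} (hj : j ∈ Finset.Icc 1 (n + 1)) : ∃ a b c, IsTri n D U T a c b ∧ med a c b = j := by
  obtain ⟨a, b, h1, hab, hs⟩ := h.exists_side_eq T
  rw [← hs] at hj
  refine h.joined_induction hT (P := fun a b => j ∈ side n D U a b →
    ∃ a b c, IsTri n D U T a c b ∧ med a c b = j) ?_ ?_ hab hj
  · intro a b ha hb h1 hj
    rw [h.side_eq_empty ha hb h1] at hj
    simp at hj
  · intro a b c ht i1 i2 hj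
    rcases ((h.mem_side_split (ht.2.2.2.bounds hT).1 (ht.2.2.2.bounds hT).2.1
      (ht.2.1.bounds hT).2.1 ht.1).1.mp hj) with h' | h' | h'
    · exact ⟨a, b, c, ht, h'.symm⟩
    · exact i1 h'
    · exact i2 h'

end Coordinates

section Spine

variable {T : Finset (ℕ × ℕ)}

theorem triWith_iff {a b c : ℕ} (hab : a < b) (hb : b ≤ n + 2) (hc : c ≤ n + 2) (hca : c ≠ a)
    (hcb : c ≠ b) : TriWith n D U T (a, b) c ↔
      Joined n D U T a c ∧ Joined n D U T c b ∧ Joined n D U T a b := by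
  rw [TriWith]
  simp only [IsTriangleOf]
  split_ifs with h1 h2
  · rw [← joined_of_lt h1, ← joined_of_lt hab, ← joined_of_lt (h1.trans hab)]
    have : Joined n D U T a c ↔ Joined n D U T c a := ⟨Joined.symm, Joined.symm⟩
    tauto
  · rw [← joined_of_lt h2, ← joined_of_lt hab, ← joined_of_lt (by omega : a < c)]
    have : a < c := by omega
    tauto
  · rw [← joined_of_lt hab, ← joined_of_lt (by omega : b < c), ← joined_of_lt (by omega : a < c)]
    have : Joined n D U T b c ↔ Joined n D U T c b := ⟨Joined.symm, Joined.symm⟩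
    have : b < c := by omega
    tauto

theorem midOf_eq_med {a b c : ℕ} (hab : a < b) : midOf a b c = med a c b := by
  simp only [midOf, med]
  split_ifs <;> omega

theorem joined_of_mem (hT : IsTriangulation n D U T) {a b : ℕ} (hm : (a, b) ∈ T) :
    a < b ∧ b ≤ n + 2 ∧ Joined n D U T a b ∧ relpos n D U a b ≠ 1 ∧ relpos n D U b a ≠ 1 := by
  obtain ⟨⟨h1, h2⟩, h3⟩ := hT.1 _ hm
  refine ⟨h1, h2, (joined_of_lt h1).mpr (Or.inl hm), fun he => h3 ⟨⟨h1, h2⟩, Or.inl he⟩,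
    fun he => h3 ⟨⟨h1, h2⟩, Or.inr he⟩⟩

theorem IsLabelling.spineSrc_eq (h : IsLabelling n D U) (hT : IsTriangulation n D U T)
    {a b c : ℕ} (hab : a < b) (ht : IsTri n D U T a c b) :
    spineSrc n D U T (a, b) = med a c b := by
  have hb := (ht.2.2.2.bounds hT).2.1
  have key : ∀ {d}, StrictBetween n D U a b d ∧ TriWith n D U T (a, b) d ↔
      d ≤ n + 2 ∧ IsTri n D U T a d b := by
    intro d
    rw [h.strictBetween_iff (by omega) hb, and_assoc]
    refine and_congr_right fun hd => and_congr_right fun hcc => ?_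
    exact triWith_iff hab hb hd hcc.ne.1.symm hcc.ne.2.1
  have hex : ∃ d, StrictBetween n D U a b d ∧ TriWith n D U T (a, b) d :=
    ⟨c, key.mpr ⟨(ht.2.1.bounds hT).2.1, ht⟩⟩
  rw [spineSrc, dif_pos hex, h.isTri_unique hT (key.mp hex.choose_spec).2 ht, midOf_eq_med hab]

theorem IsLabelling.spineTgt_eq (h : IsLabelling n D U) (hT : IsTriangulation n D U T)
    {a b d : ℕ} (hab : a < b) (ht : IsTri n D U T b d a) :
    spineTgt n D U T (a, b) = med b d a := by
  have hb := (ht.2.2.2.bounds hT).1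
  have key : ∀ {c}, StrictBetween n D U b a c ∧ TriWith n D U T (a, b) c ↔
      c ≤ n + 2 ∧ IsTri n D U T b c a := by
    intro c
    rw [h.strictBetween_iff hb (by omega), and_assoc]
    refine and_congr_right fun hc => and_congr_right fun hcc => ?_
    rw [triWith_iff hab hb hc hcc.ne.2.1 hcc.ne.1.symm]
    have e1 : Joined n D U T b c ↔ Joined n D U T c b := ⟨Joined.symm, Joined.symm⟩
    have e2 : Joined n D U T a c ↔ Joined n D U T c a := ⟨Joined.symm, Joined.symm⟩
    have e3 : Joined n D U T a b ↔ Joined n D U T b a := ⟨Joined.symm, Joined.symm⟩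
    tauto
  have hex : ∃ c, StrictBetween n D U b a c ∧ TriWith n D U T (a, b) c :=
    ⟨d, key.mpr ⟨(ht.2.1.bounds hT).2.1, ht⟩⟩
  have he := h.isTri_unique hT (key.mp hex.choose_spec).2 ht
  rw [spineTgt, dif_pos hex, midOf_eq_med hab]
  have : med a d b = med b d a := by
    simp only [med]; omega
  rw [← this]
  exact congrArg (fun x => med a x b) he

end Spine

section Flips

variable {T : Finset (ℕ × ℕ)}

/-- Replace the diagonal `ab` of `T` by the diagonal `cd`. -/
def flip (T : Finset (ℕ × ℕ)) (a b c d : ℕ) : Finset (ℕ × ℕ) :=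
  insert (min c d, max c d) (T.erase (min a b, max a b))

theorem Ccw.crossing {x y z w : ℕ} (h1 : Ccw n D U x z y) (h2 : Ccw n D U y w x) :
    Ccw n D U z y w ∧ Ccw n D U w x z := by
  simp only [Ccw, Cyc] at *
  omega

theorem min_max_eq_iff {x y a b : ℕ} : (min x y, max x y) = (min a b, max a b) ↔
    (x = a ∧ y = b) ∨ (x = b ∧ y = a) := by
  rw [Prod.mk.injEq]; omega

theorem IsLabelling.isTriangulation_of (h : IsLabelling n D U)
    (h1 : ∀ δ ∈ T, IsInternalDiag n D U δ)
    (h2 : ∀ x y z w, Joined n D U T x y → Joined n D U T z w →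
      ¬ (Ccw n D U x z y ∧ Ccw n D U y w x))
    (h3 : ∀ x y, x ≤ n + 2 → y ≤ n + 2 → x ≠ y →
      (∀ z w, Joined n D U T z w → ¬ (Ccw n D U x z y ∧ Ccw n D U y w x)) →
      Joined n D U T x y) : IsTriangulation n D U T := by
  refine ⟨h1, fun δ hδ δ' hδ' hcr => ?_, fun δ hδ hm => ?_⟩
  · have d1 := (h1 _ hδ).1
    have d2 := (h1 _ hδ').1
    have j1 : Joined n D U T δ.1 δ.2 := (joined_of_lt d1.1).mpr (Or.inl hδ)
    have j2 : Joined n D U T δ'.1 δ'.2 := (joined_of_lt d2.1).mpr (Or.inl hδ')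
    rw [h.cross_iff d1 d2] at hcr
    exact hcr.elim (h2 _ _ _ _ j1 j2) (h2 _ _ _ _ j1 j2.symm)
  · by_contra hno
    push Not at hno
    obtain ⟨d1, d2⟩ := hδ.1
    have hj := h3 δ.1 δ.2 (by omega) d2 d1.ne fun z w hzw hx => by
      have key : ∀ {z w : ℕ}, EdgeOf n D U T z w →
          ((Ccw n D U δ.1 z δ.2 ∧ Ccw n D U δ.2 w δ.1) ∨
          (Ccw n D U δ.1 w δ.2 ∧ Ccw n D U δ.2 z δ.1)) → False := by
        intro z w he hx
        rcases he with he | ⟨he, hr⟩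
        · exact hno _ he ((h.cross_iff hδ.1 (h1 _ he).1).mpr hx)
        · obtain ⟨l1, l2⟩ := he
          simp only at l1 l2 hr
          have k1 := h.not_ccw (a := z) (b := w) (c := δ.2) (by omega) l2 d2
          have k2 := h.not_ccw (a := z) (b := w) (c := δ.1) (by omega) l2 (by omega)
          have k3 := h.not_ccw (a := w) (b := z) (c := δ.2) l2 (by omega) d2
          have k4 := h.not_ccw (a := w) (b := z) (c := δ.1) l2 (by omega) (by omega)
          rcases hx with hx | hx <;> have := hx.1.crossing hx.2 <;> tauto
      rcases le_total z w with hle | hle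
      · rw [Joined, min_eq_left hle, max_eq_right hle] at hzw
        exact key hzw (Or.inl hx)
      · rw [Joined, min_eq_right hle, max_eq_left hle] at hzw
        exact key hzw (Or.inr hx)
    rw [joined_of_lt d1] at hj
    exact hj.elim hm hδ.2

theorem IsLabelling.eq_of_ccw (h : IsLabelling n D U) {x y a c d : ℕ} (hx : x ≤ n + 2)
    (ha : a ≤ n + 2) (hdac : Ccw n D U d a c) (hxcy : Ccw n D U x c y) (hydx : Ccw n D U y d x)
    (h1 : ¬ (Ccw n D U d x a ∧ Ccw n D U a y d)) (h2 : ¬ (Ccw n D U a x c ∧ Ccw n D U c y a)) :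
    x = a := by
  refine h.pos_inj hx ha ?_
  clear hx ha
  simp only [Ccw, Cyc] at *
  omega

/-- `ab` is the common edge of the triangles `acb` and `bda` of `T`. -/
structure IsQuad (n : ℕ) (D U : Finset ℕ) (T : Finset (ℕ × ℕ)) (a b c d : ℕ) : Prop where
  left : IsTri n D U T a c b
  right : IsTri n D U T b d a

variable {a b c d : ℕ}

theorem IsQuad.swap (hq : IsQuad n D U T a b c d) : IsQuad n D U T b a d c := ⟨hq.2, hq.1⟩

theorem IsQuad.bounds (hT : IsTriangulation n D U T) (hq : IsQuad n D U T a b c d) :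
    a ≤ n + 2 ∧ b ≤ n + 2 ∧ c ≤ n + 2 ∧ d ≤ n + 2 :=
  ⟨(hq.1.2.1.bounds hT).1, (hq.2.2.1.bounds hT).1, (hq.1.2.1.bounds hT).2.1,
    (hq.2.2.1.bounds hT).2.1⟩

theorem IsQuad.ccw (hq : IsQuad n D U T a b c d) : Ccw n D U c b d ∧ Ccw n D U d a c := by
  have h1 := hq.1.1
  have h2 := hq.2.1
  simp only [Ccw, Cyc] at *
  omega

theorem IsLabelling.relpos_ne_one (h : IsLabelling n D U) (hT : IsTriangulation n D U T)
    (hq : IsQuad n D U T a b c d) :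
    relpos n D U a b ≠ 1 ∧ relpos n D U b a ≠ 1 ∧ relpos n D U c d ≠ 1 ∧ relpos n D U d c ≠ 1 := by
  obtain ⟨ha, hb, hc, hd⟩ := hq.bounds hT
  exact ⟨fun he => h.not_ccw ha hb hc he hq.1.1, fun he => h.not_ccw hb ha hd he hq.2.1,
    fun he => h.not_ccw hc hd hb he hq.ccw.1, fun he => h.not_ccw hd hc ha he hq.ccw.2⟩

theorem IsLabelling.joined_flip (h : IsLabelling n D U) (hT : IsTriangulation n D U T)
    (hq : IsQuad n D U T a b c d) {x y : ℕ} : Joined n D U (flip T a b c d) x y ↔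
      (Joined n D U T x y ∧ ¬ ((x = a ∧ y = b) ∨ (x = b ∧ y = a))) ∨
        ((x = c ∧ y = d) ∨ (x = d ∧ y = c)) := by
  rw [← min_max_eq_iff, ← min_max_eq_iff (a := c), Joined, Joined, EdgeOf, EdgeOf, flip,
    Finset.mem_insert, Finset.mem_erase]
  have hr := h.relpos_ne_one hT hq
  have : IsBoundaryEdge n D U (min x y, max x y) → (min x y, max x y) ≠ (min a b, max a b) := by
    rintro ⟨-, hb⟩ he
    rw [he] at hb
    rcases le_total a b with hle | hle <;>
      simp only [hle, min_eq_left, max_eq_right, min_eq_right, max_eq_left] at hb <;> tauto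
  tauto

theorem IsLabelling.isTriangulation_flip (h : IsLabelling n D U) (hT : IsTriangulation n D U T)
    (hq : IsQuad n D U T a b c d) : IsTriangulation n D U (flip T a b c d) := by
  obtain ⟨ha, hb, hc, hd⟩ := hq.bounds hT
  obtain ⟨q1, q2⟩ := hq.ccw
  have hr := h.relpos_ne_one hT hq
  have ncross : ∀ {x y : ℕ}, Joined n D U T x y → ¬ ((x = a ∧ y = b) ∨ (x = b ∧ y = a)) →
      ¬ (Ccw n D U x c y ∧ Ccw n D U y d x) := by
    rintro x y hxy hne ⟨e1, e2⟩
    obtain ⟨hx, hy, -⟩ := hxy.bounds hT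
    refine hne (Or.inl ⟨h.eq_of_ccw hx ha q2 e1 e2 ?_ ?_, h.eq_of_ccw hy hb q1 e2 e1 ?_ ?_⟩)
    · exact h.not_ccw_of_joined hT hq.2.2.2.1 hxy
    · exact h.not_ccw_of_joined hT hq.1.2.1 hxy
    · exact h.not_ccw_of_joined hT hq.1.2.2.1 hxy.symm
    · exact h.not_ccw_of_joined hT hq.2.2.1 hxy.symm
  have hrot : ∀ {x y z w : ℕ}, Ccw n D U x z y ∧ Ccw n D U y w x →
      Ccw n D U z y w ∧ Ccw n D U w x z := fun hx => hx.1.crossing hx.2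
  refine h.isTriangulation_of ?_ ?_ ?_
  · intro δ hδ
    rw [flip, Finset.mem_insert, Finset.mem_erase] at hδ
    rcases hδ with rfl | hδ
    · have := q1.ne
      refine ⟨⟨by simp only; omega, by simp only; omega⟩, ?_⟩
      rintro ⟨-, hb⟩
      rcases le_total c d with hle | hle <;>
        simp only [hle, min_eq_left, max_eq_right, min_eq_right, max_eq_left] at hb <;> tauto
    · exact hT.1 _ hδ.2
  · intro x y z w h1 h2 hx
    rw [h.joined_flip hT hq] at h1 h2
    rcases h1 with ⟨h1, n1⟩ | h1
    · rcases h2 with ⟨h2, n2⟩ | ⟨rfl, rfl⟩ | ⟨rfl, rfl⟩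
      · exact h.not_ccw_of_joined hT h1 h2 hx
      · exact ncross h1 n1 hx
      · exact ncross h1.symm (by tauto) hx.symm
    · rcases h2 with ⟨h2, n2⟩ | h2
      · have := hrot hx
        rcases h1 with ⟨rfl, rfl⟩ | ⟨rfl, rfl⟩
        · exact ncross h2.symm (by tauto) this.symm
        · exact ncross h2 n2 this
      · have := hx.1.ne
        have := hx.2.ne
        omega
  · intro x y hx hy hxy hno
    have hj := fun z w => h.joined_flip hT hq (x := z) (y := w)
    have b1 := hq.1.1.ne
    have b2 := hq.2.1.ne
    have b3 := q1.ne
    have jac := (hj a c).mpr (Or.inl ⟨hq.1.2.1, by omega⟩)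
    have jcb := (hj c b).mpr (Or.inl ⟨hq.1.2.2.1, by omega⟩)
    have jbd := (hj b d).mpr (Or.inl ⟨hq.2.2.1, by omega⟩)
    have jda := (hj d a).mpr (Or.inl ⟨hq.2.2.2.1, by omega⟩)
    have jcd := (hj c d).mpr (Or.inr (Or.inl ⟨rfl, rfl⟩))
    by_contra hnj
    have hnT : ¬ Joined n D U T x y := by
      intro hjT
      rw [hj, not_or, not_and, not_not] at hnj
      rcases hnj.1 hjT with ⟨rfl, rfl⟩ | ⟨rfl, rfl⟩
      · exact hno _ _ jcd ⟨hq.1.1, hq.2.1⟩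
      · exact hno _ _ jcd.symm ⟨hq.2.1, hq.1.1⟩
    have hnc : ∀ {z w : ℕ}, Joined n D U (flip T a b c d) z w →
        ¬ (Ccw n D U z x w ∧ Ccw n D U w y z) ∧ ¬ (Ccw n D U z y w ∧ Ccw n D U w x z) := by
      intro z w hzw
      exact ⟨fun hc => hno _ _ hzw.symm (hrot hc), fun hc => hno _ _ hzw (hrot hc).symm⟩
    refine hnT (h.joined_of_forall hT hx hy hxy fun z w hzw hc => ?_)
    by_cases hne : (z = a ∧ w = b) ∨ (z = b ∧ w = a)
    · have hc' := hrot hc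
      rcases hne with ⟨rfl, rfl⟩ | ⟨rfl, rfl⟩
      · have e1 := h.eq_of_ccw hy ‹c ≤ n + 2› hq.1.1 hc.2 hc.1 (hnc jac).2 (hnc jcb).2
        have e2 := h.eq_of_ccw hx hd hq.2.1 hc.1 hc.2 (hnc jbd).1 (hnc jda).1
        exact hnj ((hj _ _).mpr (Or.inr (Or.inr ⟨e2, e1⟩)))
      · have e1 := h.eq_of_ccw hx ‹c ≤ n + 2› hq.1.1 hc.1 hc.2 (hnc jac).1 (hnc jcb).1
        have e2 := h.eq_of_ccw hy hd hq.2.1 hc.2 hc.1 (hnc jbd).2 (hnc jda).2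
        exact hnj ((hj _ _).mpr (Or.inr (Or.inl ⟨e1, e2⟩)))
    · exact hno _ _ ((hj _ _).mpr (Or.inl ⟨hzw, hne⟩)) hc

end Flips

section FlipCoordinates

variable {T : Finset (ℕ × ℕ)} {a b c d : ℕ}

theorem IsLabelling.med_mem_side (h : IsLabelling n D U) (ha : a ≤ n + 2) (hb : b ≤ n + 2)
    (hc : c ≤ n + 2) (hacb : Ccw n D U a c b) : med a c b ∈ side n D U a b :=
  (h.mem_side_split ha hb hc hacb).1.mpr (Or.inl rfl)

theorem notMem_side_swap {j : ℕ} (hab : a ≠ b) (hj : j ∈ side n D U a b) :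
    j ∉ side n D U b a := by
  rw [side_swap hab]
  simp [hj]

theorem IsLabelling.med_ne_med (h : IsLabelling n D U) (ha : a ≤ n + 2) (hb : b ≤ n + 2)
    (hc : c ≤ n + 2) (hd : d ≤ n + 2) (hacb : Ccw n D U a c b) (hbda : Ccw n D U b d a) :
    med a c b ≠ med b d a := fun he =>
  notMem_side_swap hacb.ne.2.2 (he ▸ h.med_mem_side ha hb hc hacb) (h.med_mem_side hb ha hd hbda)

theorem IsLabelling.isTri_flip (h : IsLabelling n D U) (hT : IsTriangulation n D U T)
    (hq : IsQuad n D U T a b c d) {p q r : ℕ} (ht : IsTri n D U T p r q)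
    (h1 : med p r q ≠ med a c b) (h2 : med p r q ≠ med b d a) :
    IsTri n D U (flip T a b c d) p r q := by
  have key : ∀ {p r q : ℕ}, IsTri n D U T p r q → med p r q ≠ med a c b →
      med p r q ≠ med b d a → ¬ ((p = a ∧ q = b) ∨ (p = b ∧ q = a)) := by
    rintro p r q ht h1 h2 (⟨rfl, rfl⟩ | ⟨rfl, rfl⟩)
    · exact h1 (by rw [h.isTri_unique hT ht hq.1])
    · exact h2 (by rw [h.isTri_unique hT ht hq.2])
  have k1 := key ht h1 h2
  have k2 := key ht.rotate (by rwa [← med_rotate]) (by rwa [← med_rotate])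
  have k3 := key ht.rotate.rotate (by rwa [← med_rotate, ← med_rotate])
    (by rwa [← med_rotate, ← med_rotate])
  refine ⟨ht.1, ?_, ?_, ?_⟩ <;> rw [h.joined_flip hT hq]
  · exact Or.inl ⟨ht.2.1, by tauto⟩
  · exact Or.inl ⟨ht.2.2.1, by tauto⟩
  · exact Or.inl ⟨ht.2.2.2, by tauto⟩

theorem IsLabelling.isQuad_flip (h : IsLabelling n D U) (hT : IsTriangulation n D U T)
    (hq : IsQuad n D U T a b c d) : IsQuad n D U (flip T a b c d) c d b a := by
  have b1 := hq.1.1.ne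
  have b2 := hq.2.1.ne
  have b3 := hq.ccw.1.ne
  refine ⟨⟨hq.ccw.1, ?_, ?_, ?_⟩, hq.ccw.2, ?_, ?_, ?_⟩ <;> rw [h.joined_flip hT hq]
  · exact Or.inl ⟨hq.1.2.2.1, by omega⟩
  · exact Or.inl ⟨hq.2.2.1, by omega⟩
  · tauto
  · exact Or.inl ⟨hq.2.2.2.1, by omega⟩
  · exact Or.inl ⟨hq.1.2.1, by omega⟩
  · tauto

theorem IsLabelling.psi_flip_pos (h : IsLabelling n D U) (ha : a ≤ n + 2) (hb : b ≤ n + 2)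
    (hc : c ≤ n + 2) (hd : d ≤ n + 2) (hacb : Ccw n D U a c b) (hbda : Ccw n D U b d a)
    (hcbd : Ccw n D U c b d) (hdac : Ccw n D U d a c) (hab : a < b) :
    (med c b d = med a c b →
      0 < psi n D U c d + psi n D U a c - psi n D U b d - psi n D U a b) ∧
    (med d a c = med a c b →
      0 < psi n D U d c + psi n D U c b - psi n D U d a - psi n D U a b) := by
  have hst := h.med_ne_med ha hb hc hd hacb hbda
  have hp := h.relpos_pos ha hc hacb.ne.1
  have hq := h.relpos_pos hc hb hacb.ne.2.1
  have hr := h.relpos_pos hb hd hbda.ne.1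
  have hw := h.relpos_pos hd ha hbda.ne.2.1
  have eab := h.relpos_add ha hc hb hacb
  have ecd := h.relpos_add hc hb hd hcbd
  have edc := h.relpos_add hd ha hc hdac
  have etot := h.relpos_add_swap hc hd hcbd.ne.2.2
  have h1 := hacb.ne
  have h2 := hbda.ne
  have h3 := hcbd.ne.2.2
  simp only [psi, ecd, eab, edc] at *
  generalize relpos n D U a c = p at *
  generalize relpos n D U c b = q at *
  generalize relpos n D U b d = r at *
  generalize relpos n D U d a = w at *
  have hn : (n : ℝ) = p + q + r + w - 3 := by
    have : (q : ℝ) + r + (w + p) = n + 3 := mod_cast etot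
    linarith
  have hpr : (0 : ℝ) < p * r := by positivity
  have hqw : (0 : ℝ) < q * w := by positivity
  clear hacb hbda hcbd hdac h eab ecd edc etot hp hq hr hw
  simp only [med] at *
  push_cast
  rw [hn]
  constructor <;> intro hm <;> split_ifs <;> first | (exfalso; omega) | nlinarith

/-- Flipping the diagonal `ab` moves `x(T)` in the direction `e_s - e_t`. -/
theorem IsLabelling.xcoord_flip (h : IsLabelling n D U) (hT : IsTriangulation n D U T)
    (hq : IsQuad n D U T a b c d) (hab : a < b) :
    ∃ κ > 0, ∀ j ∈ Finset.Icc 1 (n + 1), xcoord n D U (flip T a b c d) j =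
      xcoord n D U T j + κ * ((if j = med a c b then 1 else 0) -
        (if j = med b d a then 1 else 0)) := by
  have hT' := h.isTriangulation_flip hT hq
  have hq' := h.isQuad_flip hT hq
  obtain ⟨ha, hb, hc, hd⟩ := hq.bounds hT
  have hpos := h.psi_flip_pos ha hb hc hd hq.1.1 hq.2.1 hq.ccw.1 hq.ccw.2 hab
  have hst := h.med_ne_med ha hb hc hd hq.1.1 hq.2.1
  have hst' := h.med_ne_med hc hd hb ha hq.ccw.1 hq.ccw.2
  have x1 := h.xcoord_med hT hq.1
  have x2 := h.xcoord_med hT hq.2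
  have x3 := h.xcoord_med hT' hq'.1
  have x4 := h.xcoord_med hT' hq'.2
  have s1 := h.psi_swap ha hb hq.1.1.ne.2.2
  have s2 := h.psi_swap hc hd hq.ccw.1.ne.2.2
  have hmed : (med c b d = med a c b ∧ med d a c = med b d a) ∨
      (med d a c = med a c b ∧ med c b d = med b d a) := by
    have h1 := hq.1.1.ne
    have h2 := hq.2.1.ne
    have h3 := hq.ccw.1.ne
    clear hpos x1 x2 x3 x4 s1 s2
    simp only [med] at *
    omega
  have hother : ∀ j ∈ Finset.Icc 1 (n + 1), j ≠ med a c b → j ≠ med b d a →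
      xcoord n D U (flip T a b c d) j = xcoord n D U T j := by
    intro j hj h1 h2
    obtain ⟨p, q, r, ht, rfl⟩ := h.exists_isTri_med hT hj
    rw [h.xcoord_med hT ht, h.xcoord_med hT' (h.isTri_flip hT hq ht h1 h2)]
  rcases hmed with ⟨e1, e2⟩ | ⟨e1, e2⟩
  · refine ⟨_, hpos.1 e1, fun j hj => ?_⟩
    rw [e1] at x3
    rw [e2] at x4
    split_ifs with j1 j2 j2
    · exact absurd (j1.symm.trans j2) hst
    · rw [j1, x1, x3]; ring
    · rw [j2, x2, x4]; linarith
    · rw [hother j hj j1 j2]; ring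
  · refine ⟨_, hpos.2 e1, fun j hj => ?_⟩
    rw [e2] at x3
    rw [e1] at x4
    split_ifs with j1 j2 j2
    · exact absurd (j1.symm.trans j2) hst
    · rw [j1, x1, x4]; ring
    · rw [j2, x2, x3]; linarith
    · rw [hother j hj j1 j2]; ring

end FlipCoordinates

section Optimality

variable {T : Finset (ℕ × ℕ)} {a b c d : ℕ}

theorem IsLabelling.sum_xcoord_flip (h : IsLabelling n D U) (hT : IsTriangulation n D U T)
    (hq : IsQuad n D U T a b c d) (hab : a < b) :
    ∃ κ > 0, ∀ S ⊆ Finset.Icc 1 (n + 1), ∀ g : ℕ → ℝ,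
      ∑ j ∈ S, g j * xcoord n D U (flip T a b c d) j = ∑ j ∈ S, g j * xcoord n D U T j +
        κ * ((if med a c b ∈ S then g (med a c b) else 0) -
          (if med b d a ∈ S then g (med b d a) else 0)) := by
  obtain ⟨κ, hκ, hx⟩ := h.xcoord_flip hT hq hab
  refine ⟨κ, hκ, fun S hS g => ?_⟩
  rw [Finset.sum_congr rfl fun j hj => by rw [hx j (hS hj)]]
  simp only [mul_add, mul_sub, Finset.sum_add_distrib, Finset.sum_sub_distrib, mul_ite, mul_one,
    mul_zero, Finset.sum_ite_eq']
  split_ifs <;> ring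

theorem mem_of_joined (hab : Joined n D U T a b)
    (h1 : relpos n D U a b ≠ 1) (h2 : relpos n D U b a ≠ 1) : (min a b, max a b) ∈ T := by
  refine hab.resolve_right ?_
  rintro ⟨-, hb⟩
  rcases le_total a b with hle | hle <;>
    simp only [hle, min_eq_left, max_eq_right, min_eq_right, max_eq_left] at hb <;> tauto

/-- If the third vertex `p` of a triangle `abp` is an endpoint of a segment `pq` crossing `ab`,
then the label of the triangle lies on the side of `pq` below it exactly when `a < b`. -/
theorem IsLabelling.med_mem_side_iff (h : IsLabelling n D U) {p q : ℕ} (ha : a ≤ n + 2)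
    (hb : b ≤ n + 2) (hpq : p < q) (hq : q ≤ n + 2) (h1 : Ccw n D U p a q)
    (h2 : Ccw n D U q b p) : med b p a ∈ side n D U p q ↔ a < b := by
  rw [h.mem_side (by omega) hq hpq.ne]
  have k1 := h.pos_cmp ha hb
  have k2 := h.pos_cmp ha (w := p) (by omega)
  have k3 := h.pos_cmp ha hq
  have k4 := h.pos_cmp hb (w := p) (by omega)
  have k5 := h.pos_cmp hb hq
  have k6 := h.pos_cmp (v := p) (w := q) (by omega) hq
  have n1 := h1.ne
  have n2 := h2.ne
  have hm : (med b p a = a ∨ med b p a = b ∨ med b p a = p) := by simp only [med]; omega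
  have hab : a ≠ b := by
    rintro rfl
    simp only [Ccw, Cyc] at *
    omega
  have hbd : 1 ≤ med b p a ∧ med b p a ≤ n + 1 := by
    simp only [med]; omega
  rcases hm with hm | hm | hm <;> rw [hm] at hbd ⊢ <;> simp only [med] at hm <;>
    simp only [Ccw, Cyc, true_or, true_and] at * <;> omega

/-- A triangulation not containing `pq` has a flip creating a diagonal at `p` and removing one
that crosses `pq`. -/
theorem IsLabelling.exists_isQuad (h : IsLabelling n D U) (hT : IsTriangulation n D U T)
    {p q : ℕ} (hp : p ≤ n + 2) (hq : q ≤ n + 2) (hpq : p ≠ q) (hj : ¬ Joined n D U T p q) :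
    ∃ a b d, IsQuad n D U T a b d p ∧ Ccw n D U p a q ∧ Ccw n D U q b p := by
  obtain ⟨v, hv, hv1, hv2⟩ := h.exists_ccw hp hq hpq
    fun h1 => hj (h.joined_of_relpos hp hq h1)
  obtain ⟨a, ha, hmax⟩ := Finset.exists_max_image
    ((Finset.range (n + 3)).filter fun v => Ccw n D U p v q ∧ Joined n D U T p v)
    (fun v => relpos n D U p v)
    ⟨v, Finset.mem_filter.mpr ⟨Finset.mem_range.mpr (by omega), hv2,
      h.joined_of_relpos hp hv hv1⟩⟩
  simp only [Finset.mem_filter, Finset.mem_range, and_imp] at ha hmax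
  obtain ⟨ha, hpaq, hpa⟩ := ha
  have ha' : a ≤ n + 2 := by omega
  obtain ⟨b, hb⟩ := h.exists_isTri hT hpa.symm
    fun h1 => h.not_ccw ha' hp hq h1 hpaq.rotate
  have hb' := (hb.2.1.bounds hT).2.1
  have hqbp : Ccw n D U q b p := by
    have hbq : b ≠ q := by
      rintro rfl
      exact hj hb.2.2.1.symm
    have e1 : pos n D U b ≠ pos n D U q := fun he => hbq (h.pos_inj hb' hq he)
    have e2 := fun hc => hmax b (by omega) hc hb.2.2.1.symm
    have e3 := h.relpos_add hp ha' hb' hb.1.rotate.rotate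
    have e4 := h.relpos_pos ha' hb' hb.1.ne.1
    have e5 := hb.1
    clear hmax hv1 hv2
    simp only [Ccw, Cyc] at *
    omega
  obtain ⟨d, hd⟩ := h.exists_isTri hT hb.2.1 fun h1 => h.not_ccw ha' hb' hq h1 (by
    have := hb.1
    simp only [Ccw, Cyc] at *
    omega)
  exact ⟨a, b, d, ⟨hd, hb.rotate⟩, hpaq, hqbp⟩

theorem IsLabelling.card_cross_flip_lt (h : IsLabelling n D U) (hT : IsTriangulation n D U T)
    {p q : ℕ} (hpq : p < q) (hq : q ≤ n + 2) (hquad : IsQuad n D U T a b d p)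
    (h1 : Ccw n D U p a q) (h2 : Ccw n D U q b p) :
    ((flip T a b d p).filter fun δ => Cross n D U (p, q) δ).card <
      (T.filter fun δ => Cross n D U (p, q) δ).card := by
  have hr := h.relpos_ne_one hT hquad
  have hm := mem_of_joined hquad.1.2.2.2 hr.1 hr.2.1
  have hnc : ¬ Cross n D U (p, q) (min d p, max d p) := by
    rintro ⟨-, -, e1, e2, -⟩
    simp only at e1 e2
    omega
  have hsub : ∀ δ ∈ flip T a b d p, Cross n D U (p, q) δ →
      δ ∈ T ∧ δ ≠ (min a b, max a b) := by
    intro δ hδ hc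
    rw [flip, Finset.mem_insert, Finset.mem_erase] at hδ
    rcases hδ with rfl | hδ
    · exact absurd hc hnc
    · exact hδ.symm
  refine Finset.card_lt_card (Finset.ssubset_iff_subset_ne.mpr ⟨fun δ hδ => ?_, fun he => ?_⟩)
  · rw [Finset.mem_filter] at hδ ⊢
    exact ⟨(hsub δ hδ.1 hδ.2).1, hδ.2⟩
  · have hc : Cross n D U (p, q) (min a b, max a b) := by
      rw [h.cross_iff ⟨hpq, hq⟩ (hT.1 _ hm).1]
      rcases le_total a b with hle | hle
      · simp only [hle, min_eq_left, max_eq_right]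
        exact Or.inl ⟨h1, h2⟩
      · simp only [hle, min_eq_right, max_eq_left]
        exact Or.inr ⟨h1, h2⟩
    have : (min a b, max a b) ∈ (flip T a b d p).filter fun δ => Cross n D U (p, q) δ := by
      rw [he, Finset.mem_filter]
      exact ⟨hm, hc⟩
    rw [Finset.mem_filter] at this
    exact (hsub _ this.1 this.2).2 rfl

/-- The inequalities defining the facets of the associahedron hold at every vertex. -/
theorem IsLabelling.psi_le_sum_xcoord (h : IsLabelling n D U) (hT : IsTriangulation n D U T)
    {p q : ℕ} (hpq : p < q) (hq : q ≤ n + 2) :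
    psi n D U p q ≤ ∑ j ∈ side n D U p q, xcoord n D U T j := by
  induction hN : (T.filter fun δ => Cross n D U (p, q) δ).card using
    Nat.strong_induction_on generalizing T with
  | _ N ih =>
  subst hN
  by_cases hj : Joined n D U T p q
  · exact (h.sum_xcoord_side hT hj).ge
  obtain ⟨a, b, d, hquad, h1, h2⟩ := h.exists_isQuad hT (by omega) hq hpq.ne hj
  refine (ih _ (h.card_cross_flip_lt hT hpq hq hquad h1 h2)
    (h.isTriangulation_flip hT hquad) rfl).trans ?_
  obtain ⟨ha, hb, -, -⟩ := hquad.bounds hT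
  have hm := h.med_mem_side_iff ha hb hpq hq h1 h2
  rcases lt_or_gt_of_ne hquad.1.1.ne.2.2 with hab | hab
  · obtain ⟨κ, hκ, hS⟩ := h.sum_xcoord_flip hT hquad hab
    have := hS (side n D U p q) (side_subset p q) (fun _ => 1)
    simp only [one_mul] at this
    rw [this, if_pos (hm.mpr hab)]
    have : κ * ((if med a d b ∈ side n D U p q then (1 : ℝ) else 0) - 1) ≤ 0 := by
      split_ifs <;> nlinarith
    linarith
  · obtain ⟨κ, hκ, hS⟩ := h.sum_xcoord_flip hT hquad.swap hab
    have := hS (side n D U p q) (side_subset p q) (fun _ => 1)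
    have hf : flip T b a p d = flip T a b d p := by
      rw [flip, flip, min_comm p, max_comm p, min_comm b, max_comm b]
    simp only [one_mul, hf] at this
    rw [this, if_neg (fun hmem => absurd (hm.mp hmem) (by omega))]
    have : κ * (0 - (if med a d b ∈ side n D U p q then (1 : ℝ) else 0)) ≤ 0 := by
      split_ifs <;> nlinarith
    linarith

/-- If the spine is compatible with `u`, then `u` pairs with a vector satisfying the tight
facet inequalities at `T` at least as with a constant vector. -/
theorem IsLabelling.le_sum_side (h : IsLabelling n D U) (hT : IsTriangulation n D U T)
    {u y : ℕ → ℝ} (hu : ∀ δ ∈ T, u (spineSrc n D U T δ) ≤ u (spineTgt n D U T δ))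
    (hneg : ∀ a b, Joined n D U T a b → a < b → ∑ j ∈ side n D U a b, y j ≤ 0)
    (hpos : ∀ a b, Joined n D U T a b → b < a → 0 ≤ ∑ j ∈ side n D U a b, y j)
    (ht : IsTri n D U T a c b) :
    u (med a c b) * ∑ j ∈ side n D U a b, y j ≤ ∑ j ∈ side n D U a b, u j * y j := by
  have sub : ∀ {p q z : ℕ}, IsTri n D U T q z p →
      (∀ c, IsTri n D U T p c q →
        u (med p c q) * ∑ j ∈ side n D U p q, y j ≤ ∑ j ∈ side n D U p q, u j * y j) →
      u (med q z p) * ∑ j ∈ side n D U p q, y j ≤ ∑ j ∈ side n D U p q, u j * y j := by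
    intro p q z hz hP
    obtain ⟨hq, hp, -⟩ := hz.2.2.2.bounds hT
    have hzb := (hz.2.1.bounds hT).2.1
    have hr : relpos n D U q p ≠ 1 := fun h1 => h.not_ccw hq hp hzb h1 hz.1
    by_cases h1 : relpos n D U p q = 1
    · simp [h.side_eq_empty hp hq h1]
    have hj := hz.2.2.2.symm
    obtain ⟨e, he⟩ := h.exists_isTri hT hj h1
    have hm := mem_of_joined hj h1 hr
    refine le_trans ?_ (hP e he)
    rcases lt_or_gt_of_ne hz.1.ne.2.2 with hlt | hlt
    · rw [min_eq_right hlt.le, max_eq_left hlt.le] at hm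
      have := hu _ hm
      rw [h.spineSrc_eq hT hlt hz, h.spineTgt_eq hT hlt he] at this
      exact mul_le_mul_of_nonneg_right this (hpos p q hj hlt)
    · rw [min_eq_left hlt.le, max_eq_right hlt.le] at hm
      have := hu _ hm
      rw [h.spineSrc_eq hT hlt he, h.spineTgt_eq hT hlt hz] at this
      exact mul_le_mul_of_nonpos_right this (hneg p q hj hlt)
  refine h.joined_induction hT (P := fun a b => ∀ c, IsTri n D U T a c b →
    u (med a c b) * ∑ j ∈ side n D U a b, y j ≤ ∑ j ∈ side n D U a b, u j * y j)
    ?_ ?_ ht.2.2.2 c ht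
  · intro a b ha hb h1 c _
    simp [h.side_eq_empty ha hb h1]
  · intro a b c' ht' i1 i2 c ht
    obtain rfl := h.isTri_unique hT ht ht'
    have s1 := sub ht.rotate i1
    have s2 := sub ht.rotate.rotate i2
    rw [← med_rotate] at s1
    rw [← med_rotate, ← med_rotate] at s2
    rw [h.sum_side_tri hT ht, h.sum_side_tri hT ht (fun j => u j * y j)]
    linarith

end Optimality

end Spines

namespace Spines

/-- For every triangulation `T` and every `u ∈ ℝ^{n+1}`, the point
`x(T)` maximizes `⟨u, ·⟩` over all points `x(T')` iff `u_{s_δ} ≤ u_{t_δ}` for every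
diagonal `δ ∈ T`. -/
theorem normal_cone_of_triangulation (n : ℕ) (hn : 1 ≤ n) (D U : Finset ℕ)
    (hUD : D ∪ U = Finset.Icc 1 (n + 1)) (hdisj : Disjoint D U)
    (T : Finset (ℕ × ℕ)) (hT : IsTriangulation n D U T) (u : ℕ → ℝ) :
    (∀ T' : Finset (ℕ × ℕ), IsTriangulation n D U T' →
        ∑ j ∈ Finset.Icc 1 (n + 1), u j * xcoord n D U T' j
          ≤ ∑ j ∈ Finset.Icc 1 (n + 1), u j * xcoord n D U T j)
      ↔ ∀ δ ∈ T, u (spineSrc n D U T δ) ≤ u (spineTgt n D U T δ) := by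
  have h : IsLabelling n D U := ⟨hUD, hdisj⟩
  constructor
  · rintro hmax ⟨a, b⟩ hm
    obtain ⟨hab, hb, hj, r1, r2⟩ := joined_of_mem hT hm
    obtain ⟨c, hc⟩ := h.exists_isTri hT hj r1
    obtain ⟨d, hd⟩ := h.exists_isTri hT hj.symm r2
    have hq : IsQuad n D U T a b c d := ⟨hc, hd⟩
    obtain ⟨ha, -, hc', hd'⟩ := hq.bounds hT
    obtain ⟨κ, hκ, hS⟩ := h.sum_xcoord_flip hT hq hab
    have hle := hmax _ (h.isTriangulation_flip hT hq)
    have hs := side_subset a b (h.med_mem_side ha hb hc' hc.1)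
    have ht := side_subset b a (h.med_mem_side hb ha hd' hd.1)
    rw [hS _ subset_rfl u, if_pos hs, if_pos ht] at hle
    rw [h.spineSrc_eq hT hab hc, h.spineTgt_eq hT hab hd]
    nlinarith
  · intro hu T' hT'
    set y : ℕ → ℝ := fun j => xcoord n D U T j - xcoord n D U T' j with hy
    have hneg : ∀ a b, Joined n D U T a b → a < b → ∑ j ∈ side n D U a b, y j ≤ 0 := by
      intro a b hj hab
      have := h.psi_le_sum_xcoord hT' hab (hj.bounds hT).2.1
      rw [hy, Finset.sum_sub_distrib, h.sum_xcoord_side hT hj]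
      linarith
    have htot : ∑ j ∈ Finset.Icc 1 (n + 1), y j = 0 := by
      rw [hy, Finset.sum_sub_distrib, h.sum_xcoord hT, h.sum_xcoord hT', sub_self]
    have hpos : ∀ a b, Joined n D U T a b → b < a → 0 ≤ ∑ j ∈ side n D U a b, y j := by
      intro a b hj hab
      have := hneg b a hj.symm hab
      have := sum_side_swap (n := n) (D := D) (U := U) hab.ne y
      linarith
    obtain ⟨a, b, h1, hj, hs⟩ := h.exists_side_eq T
    obtain ⟨ha, hb, hne⟩ := hj.bounds hT
    have := h.relpos_add_swap ha hb hne
    obtain ⟨c, hc⟩ := h.exists_isTri hT hj (by omega)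
    have hmain := h.le_sum_side hT hu hneg hpos hc
    rw [hs, htot, mul_zero] at hmain
    simp only [hy, mul_sub, Finset.sum_sub_distrib] at hmain
    linarith

end Spines
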